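/- Let f : [0,∞) × ℝ → ℝ and g : ℝ → ℝ be locally Lipschitz, with g even, g(x) ≠ 0 for all x, lim_{|x|→∞} g(x) = σ ≠ 0, and sup_{x,t} x·f(x,t) ≤ ρ < ∞. If additionally inf_{x,t} x·f(x,t)/g(x)² = μ > −1/2, then the unique continuous adapted solution X of dX(t) = f(X(t),t) dt + g(X(t)) dB(t), X(0) = x₀, satisfies limsup_{t→∞} |X(t)|/√(2t log log t) = |σ| almost surely. -/

import Mathlib

open Filter Real Set MeasureTheory

/-- The generator of `dX = f(X,t) dt + g(X) dB` applied to `φ`, at the point `x` and time `t`. -/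
noncomputable def sdeGenerator (f : ℝ → ℝ → ℝ) (g φ : ℝ → ℝ) (x t : ℝ) : ℝ :=
  f x t * deriv φ x + (1 / 2) * (g x) ^ 2 * deriv (deriv φ) x

/-- `X` is a continuous adapted solution, started at `x₀`, of the martingale problem with
drift `f` and diffusion coefficient `g`. -/
structure SolvesMartingaleProblem {Om : Type*} {m0 : MeasurableSpace Om} (μ : Measure Om)
    (F : Filtration ℝ m0) (f : ℝ → ℝ → ℝ) (g : ℝ → ℝ) (x₀ : ℝ) (X : ℝ → Om → ℝ) : Prop where
  continuous_drift : Continuous fun p : ℝ × ℝ => f p.1 p.2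
  continuous_diffusion : Continuous g
  adapted : Adapted F X
  continuousOn_path : ∀ ω, ContinuousOn (fun t => X t ω) (Ici 0)
  initial : ∀ ω, X 0 ω = x₀
  martingale : ∀ φ : ℝ → ℝ, ContDiff ℝ 2 φ → HasCompactSupport φ →
    Martingale (fun t ω => φ (X t ω) - ∫ s in Ioc (0:ℝ) t, sdeGenerator f g φ (X s ω) s) F μ

/-- A Grönwall lower bound for continuous functions satisfying an integral inequality. -/
theorem gronwall_integral_lower {m : ℝ → ℝ} {s t c δ : ℝ} (hst : s ≤ t) (hc : 0 < c)
    (hm : Continuous m)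
    (h : ∀ u ∈ Icc s t, m s - δ + c * ∫ r in s..u, m r ≤ m u) :
    (m s - δ) * exp (c * (t - s)) ≤ m t := by
  set y : ℝ → ℝ := fun u => ∫ r in s..u, m r with hy
  have hyd : ∀ u, HasDerivAt y (m u) u := fun u =>
    intervalIntegral.integral_hasDerivAt_right (hm.intervalIntegrable _ _)
      hm.aestronglyMeasurable.stronglyMeasurableAtFilter hm.continuousAt
  set z : ℝ → ℝ := fun u => exp (-(c * (u - s))) * (c * y u + (m s - δ)) with hz
  have hzd : ∀ u, HasDerivAt z (exp (-(c * (u - s))) * c * (m u - (m s - δ + c * y u))) u := by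
    intro u
    have h1 : HasDerivAt (fun u => exp (-(c * (u - s)))) (exp (-(c * (u - s))) * (-(c * 1))) u :=
      ((((hasDerivAt_id u).sub_const s).const_mul c).neg).exp
    have h2 := h1.mul (((hyd u).const_mul c).add_const (m s - δ))
    refine h2.congr_deriv ?_
    ring
  have hmono : MonotoneOn z (Icc s t) := by
    refine monotoneOn_of_deriv_nonneg (convex_Icc s t)
      (fun u _ => (hzd u).continuousAt.continuousWithinAt)
      (fun u _ => (hzd u).differentiableAt.differentiableWithinAt) ?_
    intro u hu
    rw [interior_Icc] at hu
    rw [(hzd u).deriv]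
    have := h u (Ioo_subset_Icc_self hu)
    have : 0 ≤ m u - (m s - δ + c * y u) := by simp only [hy]; linarith
    positivity
  have h3 := hmono (left_mem_Icc.2 hst) (right_mem_Icc.2 hst) hst
  have h4 : m s - δ ≤ exp (-(c * (t - s))) * (c * y t + (m s - δ)) := by
    simpa [hz, hy] using h3
  have h5 := h t (right_mem_Icc.2 hst)
  have h6 : exp (-(c * (t - s))) * exp (c * (t - s)) = 1 := by
    rw [← Real.exp_add]; simp
  calc (m s - δ) * exp (c * (t - s))
      ≤ exp (-(c * (t - s))) * (c * y t + (m s - δ)) * exp (c * (t - s)) :=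
        mul_le_mul_of_nonneg_right h4 (exp_pos _).le
    _ = c * y t + (m s - δ) := by
        linear_combination (c * y t + (m s - δ)) * h6
    _ ≤ m t := by simp only [hy] at *; linarith

namespace SolvesMartingaleProblem

variable {Om : Type*} {m0 : MeasurableSpace Om} {μ : Measure Om}
  {F : Filtration ℝ m0} {f : ℝ → ℝ → ℝ} {g : ℝ → ℝ} {x₀ : ℝ} {X : ℝ → Om → ℝ}

theorem measurable (hX : SolvesMartingaleProblem μ F f g x₀ X) (t : ℝ) : Measurable (X t) :=
  (hX.adapted t).mono (F.le t) le_rfl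

theorem continuous_path_max (hX : SolvesMartingaleProblem μ F f g x₀ X) (ω : Om) :
    Continuous fun t => X (max t 0) ω :=
  (hX.continuousOn_path ω).comp_continuous (by fun_prop) fun t => le_max_right t 0

theorem measurable_uncurry (hX : SolvesMartingaleProblem μ F f g x₀ X) :
    Measurable (fun p : ℝ × Om => X (max p.1 0) p.2) :=
  measurable_uncurry_of_continuous_of_measurable (u := fun t ω => X (max t 0) ω)
    hX.continuous_path_max fun _ => hX.measurable _

variable [IsProbabilityMeasure μ]

theorem integrable_of_bounded (hX : SolvesMartingaleProblem μ F f g x₀ X) {q : ℝ → ℝ}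
    (hq : Continuous q) {C : ℝ} (hqC : ∀ x, |q x| ≤ C) (t : ℝ) :
    Integrable (fun ω => q (X t ω)) μ :=
  Integrable.of_bound (hq.measurable.comp (hX.measurable t)).aestronglyMeasurable C
    (ae_of_all _ fun _ => hqC _)

theorem continuous_setIntegral (hX : SolvesMartingaleProblem μ F f g x₀ X) {q : ℝ → ℝ}
    (hq : Continuous q) {C : ℝ} (hqC : ∀ x, |q x| ≤ C) (B : Set Om) :
    Continuous fun t => ∫ ω in B, q (X (max t 0) ω) ∂μ := by
  refine continuous_of_dominated (bound := fun _ => C)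
    (fun t => (hq.measurable.comp (hX.measurable _)).aestronglyMeasurable)
    (fun _ => ae_of_all _ fun _ => hqC _) (integrable_const _)
    (ae_of_all _ fun ω => hq.comp (hX.continuous_path_max ω))

/-- Dynkin's formula, as an inequality: a lower bound for the generator of a compactly supported
test function yields a lower bound for its expected growth. -/
theorem setIntegral_add_le (hX : SolvesMartingaleProblem μ F f g x₀ X) {φ q : ℝ → ℝ}
    (hφ : ContDiff ℝ 2 φ) (hφc : HasCompactSupport φ) (hq : Continuous q) {C : ℝ}
    (hqC : ∀ x, |q x| ≤ C) (hle : ∀ x t, 0 ≤ t → q x ≤ sdeGenerator f g φ x t)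
    {s t : ℝ} (hs : 0 ≤ s) (hst : s ≤ t) {B : Set Om} (hB : MeasurableSet[F s] B) :
    ∫ ω in B, φ (X s ω) ∂μ + ∫ u in s..t, ∫ ω in B, q (X (max u 0) ω) ∂μ
      ≤ ∫ ω in B, φ (X t ω) ∂μ := by
  have hM := hX.martingale φ hφ hφc
  obtain ⟨Cφ, hCφ⟩ := hφc.exists_bound_of_continuous hφ.continuous
  have hφi : ∀ t, Integrable (fun ω => φ (X t ω)) μ := fun t =>
    hX.integrable_of_bounded hφ.continuous hCφ t
  set J : ℝ → Om → ℝ := fun t ω => ∫ r in Ioc (0:ℝ) t, sdeGenerator f g φ (X r ω) r with hJ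
  have hJi : ∀ t, Integrable (J t) μ := fun t => by
    have := (hφi t).sub (hM.integrable t)
    refine this.congr (ae_of_all _ fun ω => ?_)
    simp [hJ]
  have hMeq := hM.setIntegral_eq hst hB
  rw [integral_sub (hφi s).integrableOn (hJi s).integrableOn,
    integral_sub (hφi t).integrableOn (hJi t).integrableOn] at hMeq
  have hd1 : Continuous (deriv φ) := hφ.continuous_deriv (by norm_num)
  have hd2 : Continuous (deriv (deriv φ)) := by
    have : ContDiff ℝ 1 (deriv φ) := ((contDiff_succ_iff_deriv (n := 1)).1 hφ).2.2
    exact this.continuous_deriv (by norm_num)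
  have hgenc : Continuous fun p : ℝ × ℝ => sdeGenerator f g φ p.1 p.2 := by
    have h1 := hX.continuous_drift
    have h2 := hX.continuous_diffusion
    unfold sdeGenerator
    fun_prop
  have hpath : ∀ ω, ContinuousOn (fun r => sdeGenerator f g φ (X r ω) r) (Ici 0) := fun ω =>
    hgenc.comp_continuousOn ((hX.continuousOn_path ω).prodMk continuousOn_id)
  have hii : ∀ ω a b, 0 ≤ a → 0 ≤ b →
      IntervalIntegrable (fun r => sdeGenerator f g φ (X r ω) r) volume a b := by
    intro ω a b ha hb
    refine ((hpath ω).mono ?_).intervalIntegrable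
    intro x hx
    exact le_trans (le_min ha hb) hx.1
  have hqpath : ∀ ω, Continuous fun r => q (X (max r 0) ω) := fun ω =>
    hq.comp (hX.continuous_path_max ω)
  have hJle : ∀ ω, ∫ r in s..t, q (X (max r 0) ω) ≤ J t ω - J s ω := by
    intro ω
    have : J t ω - J s ω = ∫ r in s..t, sdeGenerator f g φ (X r ω) r := by
      simp only [hJ]
      rw [← intervalIntegral.integral_of_le hs, ← intervalIntegral.integral_of_le (hs.trans hst)]
      exact intervalIntegral.integral_interval_sub_left (hii ω _ _ le_rfl (hs.trans hst))
        (hii ω _ _ le_rfl hs)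
    rw [this]
    refine intervalIntegral.integral_mono_on hst ((hqpath ω).intervalIntegrable _ _)
      (hii ω _ _ hs (hs.trans hst)) ?_
    intro r hr
    have hr0 : 0 ≤ r := hs.trans hr.1
    rw [max_eq_left hr0]
    exact hle _ _ hr0
  have hprod : Integrable (fun p : ℝ × Om => q (X (max p.1 0) p.2))
      ((volume.restrict (Ioc s t)).prod (μ.restrict B)) :=
    Integrable.of_bound (hq.measurable.comp hX.measurable_uncurry).aestronglyMeasurable C
      (ae_of_all _ fun _ => hqC _)
  have hswap : ∫ u in s..t, ∫ ω in B, q (X (max u 0) ω) ∂μ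
      = ∫ ω in B, (∫ u in s..t, q (X (max u 0) ω)) ∂μ := by
    simp only [intervalIntegral.integral_of_le hst]
    exact integral_integral_swap hprod
  have hmono : ∫ ω in B, (∫ u in s..t, q (X (max u 0) ω)) ∂μ
      ≤ ∫ ω in B, (J t ω - J s ω) ∂μ := by
    refine integral_mono ?_ ((hJi t).sub (hJi s)).integrableOn hJle
    simp only [intervalIntegral.integral_of_le hst]
    exact hprod.integral_prod_right
  rw [integral_sub (hJi t).integrableOn (hJi s).integrableOn] at hmono
  rw [hswap]
  linarith

end SolvesMartingaleProblem

theorem hasDerivAt_max_zero_pow (n : ℕ) (y : ℝ) :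
    HasDerivAt (fun y : ℝ => max y 0 ^ (n + 2)) ((n + 2 : ℝ) * max y 0 ^ (n + 1)) y := by
  have hne : ∀ y : ℝ, y ≠ 0 →
      HasDerivAt (fun y : ℝ => max y 0 ^ (n + 2)) ((n + 2 : ℝ) * max y 0 ^ (n + 1)) y := by
    intro y hy
    rcases lt_or_gt_of_ne hy with h | h
    · have he : (fun y : ℝ => max y 0 ^ (n + 2)) =ᶠ[nhds y] fun _ => 0 := by
        filter_upwards [Iio_mem_nhds h] with z hz
        rw [max_eq_right (le_of_lt hz)]; simp
      rw [max_eq_right h.le]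
      simpa using (hasDerivAt_const y (0 : ℝ)).congr_of_eventuallyEq he
    · have he : (fun y : ℝ => max y 0 ^ (n + 2)) =ᶠ[nhds y] fun y => y ^ (n + 2) := by
        filter_upwards [Ioi_mem_nhds h] with z hz
        rw [max_eq_left (le_of_lt hz)]
      rw [max_eq_left h.le]
      simpa using (hasDerivAt_pow (n + 2) y).congr_of_eventuallyEq he
  refine hasDerivAt_of_hasDerivAt_of_ne' (g := fun y => (n + 2 : ℝ) * max y 0 ^ (n + 1))
    (x := 0) (fun y hy => hne y hy) ?_ ?_ y
  · fun_prop
  · fun_prop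

theorem contDiff_max_zero_pow_three : ContDiff ℝ 2 fun y : ℝ => max y 0 ^ 3 := by
  have h1 : deriv (fun y : ℝ => max y 0 ^ 3) = fun y => 3 * max y 0 ^ 2 := by
    ext y
    rw [(hasDerivAt_max_zero_pow 1 y).deriv]; norm_num
  have h2 : deriv (fun y : ℝ => 3 * max y 0 ^ 2) = fun y => 3 * (2 * max y 0) := by
    ext y
    rw [((hasDerivAt_max_zero_pow 0 y).const_mul 3).deriv]; norm_num
  refine (contDiff_succ_iff_deriv (n := 1)).2 ⟨fun y =>
    (hasDerivAt_max_zero_pow 1 y).differentiableAt, by simp, ?_⟩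
  rw [h1]
  refine (contDiff_succ_iff_deriv (n := 0)).2 ⟨fun y =>
    ((hasDerivAt_max_zero_pow 0 y).const_mul 3).differentiableAt, by simp, ?_⟩
  rw [h2]
  refine contDiff_zero.2 ?_
  fun_prop

/-- The factor `(1 - Φ / N)₊` used to cut off a test function `Φ` at level `N`. -/
noncomputable def cutoffFactor (N : ℝ) (Φ : ℝ → ℝ) (x : ℝ) : ℝ := max (1 - Φ x / N) 0

/-- The cut-off `-N (1 - Φ / N)₊³` of a test function `Φ`; it vanishes where `Φ ≥ N`, and after
addition of `N` it behaves like `3 Φ` where `Φ` is small compared with `N`. -/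
noncomputable def cutoff (N : ℝ) (Φ : ℝ → ℝ) (x : ℝ) : ℝ := -N * cutoffFactor N Φ x ^ 3

section cutoff

variable {N : ℝ} {Φ : ℝ → ℝ}

theorem cutoffFactor_nonneg (x : ℝ) : 0 ≤ cutoffFactor N Φ x := le_max_right _ _

theorem cutoffFactor_le_one (hN : 0 < N) (hΦ : ∀ x, 0 ≤ Φ x) (x : ℝ) : cutoffFactor N Φ x ≤ 1 := by
  refine max_le ?_ zero_le_one
  have := div_nonneg (hΦ x) hN.le
  linarith

theorem continuous_cutoffFactor (hΦ : Continuous Φ) : Continuous (cutoffFactor N Φ) := by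
  unfold cutoffFactor; fun_prop

theorem cutoffFactor_eq_zero_or (hN : 0 < N) (x : ℝ) :
    (cutoffFactor N Φ x = 0 ∧ N ≤ Φ x) ∨ (Φ x = N * (1 - cutoffFactor N Φ x)) := by
  unfold cutoffFactor
  rcases le_total (1 - Φ x / N) 0 with h | h
  · left
    refine ⟨max_eq_right h, ?_⟩
    have : 1 ≤ Φ x / N := by linarith
    rwa [one_le_div hN] at this
  · right
    rw [max_eq_left h]; field_simp; ring

theorem contDiff_cutoff (hΦ : ContDiff ℝ 2 Φ) : ContDiff ℝ 2 (cutoff N Φ) := by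
  have h : ContDiff ℝ 2 fun x => 1 - Φ x / N := contDiff_const.sub (hΦ.div_const N)
  exact contDiff_const.mul (contDiff_max_zero_pow_three.comp h)

theorem hasCompactSupport_cutoffFactor (hN : 0 < N) (hΦ : Tendsto Φ (cocompact ℝ) atTop) :
    HasCompactSupport (cutoffFactor N Φ) := by
  rw [hasCompactSupport_iff_eventuallyEq]
  have := hΦ.eventually_ge_atTop N
  rw [← Filter.coclosedCompact_eq_cocompact] at this
  filter_upwards [this] with x hx
  refine max_eq_right ?_
  have := (one_le_div hN).2 hx
  linarith

theorem hasCompactSupport_cutoff (hN : 0 < N) (hΦ : Tendsto Φ (cocompact ℝ) atTop) :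
    HasCompactSupport (cutoff N Φ) :=
  (hasCompactSupport_cutoffFactor hN hΦ).comp_left (g := fun w => -N * w ^ 3) (by simp)

theorem sdeGenerator_cutoff (hN : 0 < N) (hΦ : ContDiff ℝ 2 Φ) (f : ℝ → ℝ → ℝ) (g : ℝ → ℝ)
    (x t : ℝ) :
    sdeGenerator f g (cutoff N Φ) x t
      = 3 * cutoffFactor N Φ x ^ 2 * sdeGenerator f g Φ x t
        - 3 / N * g x ^ 2 * cutoffFactor N Φ x * deriv Φ x ^ 2 := by
  have hd : ∀ x, HasDerivAt Φ (deriv Φ x) x := fun x =>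
    (hΦ.differentiable (by norm_num) x).hasDerivAt
  have hΦ' : ContDiff ℝ 1 (deriv Φ) := ((contDiff_succ_iff_deriv (n := 1)).1 hΦ).2.2
  have hd' : HasDerivAt (deriv Φ) (deriv (deriv Φ) x) x :=
    (hΦ'.differentiable (by norm_num) x).hasDerivAt
  have hw : ∀ x, HasDerivAt (fun x => 1 - Φ x / N) (-(deriv Φ x / N)) x := fun x =>
    ((hd x).div_const N).const_sub 1
  have h1 : deriv (cutoff N Φ) = fun x => 3 * cutoffFactor N Φ x ^ 2 * deriv Φ x := by
    ext x
    have := ((hasDerivAt_max_zero_pow 1 (1 - Φ x / N)).comp x (hw x)).const_mul (-N)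
    refine this.deriv.trans ?_
    unfold cutoffFactor
    field_simp
    norm_num
    ring
  have h2 : deriv (deriv (cutoff N Φ)) x = 3 * (2 * cutoffFactor N Φ x * -(deriv Φ x / N))
      * deriv Φ x + 3 * cutoffFactor N Φ x ^ 2 * deriv (deriv Φ) x := by
    rw [h1]
    have := (((hasDerivAt_max_zero_pow 0 (1 - Φ x / N)).comp x (hw x)).const_mul 3).mul hd'
    refine this.deriv.trans ?_
    simp [cutoffFactor]
  unfold sdeGenerator
  rw [h2, h1]
  field_simp
  ring

theorem cutoff_add_le (hN : 0 < N) (hΦ : ∀ x, 0 ≤ Φ x) (x : ℝ) : cutoff N Φ x + N ≤ 3 * Φ x := by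
  have h0 := cutoffFactor_nonneg (N := N) (Φ := Φ) x
  have h1 := cutoffFactor_le_one hN hΦ x
  unfold cutoff
  rcases cutoffFactor_eq_zero_or (Φ := Φ) hN x with ⟨h, h'⟩ | h
  · rw [h]; linarith [hΦ x]
  · rw [h]
    generalize cutoffFactor N Φ x = w at *
    nlinarith [mul_nonneg hN.le (mul_nonneg (sq_nonneg (1 - w)) (by linarith : 0 ≤ 2 + w))]

theorem le_cutoff_add (hN : 0 < N) (hΦ : ∀ x, 0 ≤ Φ x) (x : ℝ) :
    3 * Φ x - 3 / N * Φ x ^ 2 ≤ cutoff N Φ x + N := by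
  have h0 := cutoffFactor_nonneg (N := N) (Φ := Φ) x
  have h1 := cutoffFactor_le_one hN hΦ x
  unfold cutoff
  rcases cutoffFactor_eq_zero_or (Φ := Φ) hN x with ⟨h, h'⟩ | h
  · rw [h]
    have : Φ x * N ≤ Φ x ^ 2 := by nlinarith [hΦ x]
    have : Φ x ≤ Φ x ^ 2 / N := by rwa [le_div_iff₀ hN]
    have e : 3 / N * Φ x ^ 2 = 3 * (Φ x ^ 2 / N) := by ring
    rw [e]; norm_num; linarith
  · have e : 3 / N * Φ x ^ 2 = 3 * (N * (1 - cutoffFactor N Φ x) ^ 2) := by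
      rw [h]; field_simp
    rw [e]
    rw [h]
    generalize cutoffFactor N Φ x = w at *
    nlinarith [mul_nonneg hN.le (pow_nonneg (by linarith : 0 ≤ 1 - w) 3)]

theorem three_mul_sq_cutoffFactor_mul_le (hN : 0 < N) (hΦ : ∀ x, 0 ≤ Φ x) (x : ℝ) :
    3 * cutoffFactor N Φ x ^ 2 * Φ x ≤ cutoff N Φ x + N := by
  have h0 := cutoffFactor_nonneg (N := N) (Φ := Φ) x
  have h1 := cutoffFactor_le_one hN hΦ x
  unfold cutoff
  rcases cutoffFactor_eq_zero_or (Φ := Φ) hN x with ⟨h, h'⟩ | h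
  · rw [h]; norm_num; linarith
  · rw [h]
    generalize cutoffFactor N Φ x = w at *
    have : 0 ≤ N * ((1 - w) ^ 2 * (1 + 2 * w)) := by positivity
    nlinarith

theorem cutoff_add_sub_le (hN : 0 < N) (hΦ : ∀ x, 0 ≤ Φ x) (x : ℝ) :
    cutoff N Φ x + N - 3 / N * Φ x ^ 2 ≤ 3 * cutoffFactor N Φ x ^ 2 * Φ x := by
  have h0 := cutoffFactor_nonneg (N := N) (Φ := Φ) x
  have h1 := cutoffFactor_le_one hN hΦ x
  unfold cutoff
  rcases cutoffFactor_eq_zero_or (Φ := Φ) hN x with ⟨h, h'⟩ | h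
  · rw [h]
    have : N * N ≤ Φ x ^ 2 := by nlinarith [hΦ x]
    have : N ≤ Φ x ^ 2 / N := by rwa [le_div_iff₀ hN]
    have e : 3 / N * Φ x ^ 2 = 3 * (Φ x ^ 2 / N) := by ring
    rw [e]; norm_num; linarith
  · have e : 3 / N * Φ x ^ 2 = 3 * (N * (1 - cutoffFactor N Φ x) ^ 2) := by
      rw [h]; field_simp
    rw [e]
    rw [h]
    generalize cutoffFactor N Φ x = w at *
    have : 0 ≤ N * (w * (1 - w) ^ 2) := by positivity
    nlinarith [mul_nonneg hN.le (pow_nonneg (by linarith : 0 ≤ 1 - w) 2)]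

theorem cutoff_add_nonneg (hN : 0 < N) (hΦ : ∀ x, 0 ≤ Φ x) (x : ℝ) : 0 ≤ cutoff N Φ x + N := by
  refine le_trans ?_ (three_mul_sq_cutoffFactor_mul_le hN hΦ x)
  have := hΦ x
  positivity

theorem abs_cutoff_add_le (hN : 0 < N) (hΦ : ∀ x, 0 ≤ Φ x) (x : ℝ) : |cutoff N Φ x + N| ≤ N := by
  rw [abs_of_nonneg (cutoff_add_nonneg hN hΦ x)]
  have : 0 ≤ N * cutoffFactor N Φ x ^ 3 :=
    mul_nonneg hN.le (pow_nonneg (cutoffFactor_nonneg x) 3)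
  unfold cutoff
  linarith

end cutoff

namespace SolvesMartingaleProblem

variable {Om : Type*} {m0 : MeasurableSpace Om} {μ : Measure Om} [IsProbabilityMeasure μ]
  {F : Filtration ℝ m0} {f : ℝ → ℝ → ℝ} {g : ℝ → ℝ} {x₀ : ℝ} {X : ℝ → Om → ℝ}

theorem integrable_cutoff_add (hX : SolvesMartingaleProblem μ F f g x₀ X) {Φ : ℝ → ℝ} {N : ℝ}
    (hN : 0 < N) (hΦ : ContDiff ℝ 2 Φ) (hΦ0 : ∀ x, 0 ≤ Φ x) (t : ℝ) :
    Integrable (fun ω => cutoff N Φ (X t ω) + N) μ :=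
  hX.integrable_of_bounded (q := fun x => cutoff N Φ x + N)
    ((contDiff_cutoff hΦ).continuous.add continuous_const) (abs_cutoff_add_le hN hΦ0) t

theorem setIntegral_cutoff_le (hX : SolvesMartingaleProblem μ F f g x₀ X) {Φ : ℝ → ℝ} {c N : ℝ}
    (hN : 0 < N) (hΦ : ContDiff ℝ 2 Φ) (hΦ0 : ∀ x, 0 ≤ Φ x)
    (hΦt : Tendsto Φ (cocompact ℝ) atTop) (hc : 0 < c)
    (hgen : ∀ x t, 0 ≤ t → sdeGenerator f g Φ x t ≤ c * Φ x)
    {s t : ℝ} (hs : 0 ≤ s) (hst : s ≤ t) {B : Set Om} (hB : MeasurableSet[F s] B) :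
    ∫ ω in B, (cutoff N Φ (X t ω) + N) ∂μ
      ≤ exp (c * (t - s)) * ∫ ω in B, (cutoff N Φ (X s ω) + N) ∂μ := by
  set q : ℝ → ℝ := fun x => -c * (cutoff N Φ x + N) with hq
  have hcutc : Continuous (cutoff N Φ) := (contDiff_cutoff hΦ).continuous
  have hqc : Continuous q := by fun_prop
  have hqC : ∀ x, |q x| ≤ c * N := fun x => by
    simp only [hq, abs_mul, abs_neg, abs_of_pos hc]
    exact mul_le_mul_of_nonneg_left (abs_cutoff_add_le hN hΦ0 x) hc.le
  have hgq : ∀ x t, 0 ≤ t → q x ≤ sdeGenerator f g (fun x => -cutoff N Φ x) x t := by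
    intro x t ht
    have e : sdeGenerator f g (fun x => -cutoff N Φ x) x t = -sdeGenerator f g (cutoff N Φ) x t := by
      have : deriv (fun x => -cutoff N Φ x) = fun x => -deriv (cutoff N Φ) x := by
        ext x; exact deriv.fun_neg
      simp only [sdeGenerator, this, deriv.fun_neg]
      ring
    rw [e, sdeGenerator_cutoff hN hΦ]
    have h1 := three_mul_sq_cutoffFactor_mul_le hN hΦ0 x
    have h2 : 3 * cutoffFactor N Φ x ^ 2 * sdeGenerator f g Φ x t
        ≤ 3 * cutoffFactor N Φ x ^ 2 * (c * Φ x) :=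
      mul_le_mul_of_nonneg_left (hgen x t ht) (by positivity)
    have h3 : 0 ≤ 3 / N * g x ^ 2 * cutoffFactor N Φ x * deriv Φ x ^ 2 := by
      have := cutoffFactor_nonneg (N := N) (Φ := Φ) x
      positivity
    have h4 := mul_le_mul_of_nonneg_left h1 hc.le
    simp only [hq]
    linarith
  set m : ℝ → ℝ := fun u => ∫ ω in B, -(cutoff N Φ (X (max u 0) ω) + N) ∂μ with hm
  have hmc : Continuous m :=
    hX.continuous_setIntegral (q := fun x => -(cutoff N Φ x + N)) (C := N) (by fun_prop)
      (fun x => by rw [abs_neg]; exact abs_cutoff_add_le hN hΦ0 x) B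
  have key := gronwall_integral_lower (m := m) (δ := 0) hst hc hmc ?_
  · simp only [hm, max_eq_left hs, max_eq_left (hs.trans hst), integral_neg] at key
    linarith
  · intro u hu
    have h := hX.setIntegral_add_le (φ := fun x => -cutoff N Φ x) (contDiff_cutoff hΦ).neg
      ((hasCompactSupport_cutoff hN hΦt).comp_left (g := Neg.neg) neg_zero) hqc hqC hgq hs hu.1 hB
    have e1 : ∀ v, 0 ≤ v → m v = ∫ ω in B, -cutoff N Φ (X v ω) ∂μ - N * μ.real B := by
      intro v hv
      have h1 := (hX.integrable_cutoff_add hN hΦ hΦ0 v).integrableOn (s := B)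
      have h2 : IntegrableOn (fun _ : Om => N) B μ := (integrable_const N).integrableOn
      have h3 : ∫ ω in B, N ∂μ = N * μ.real B := by simp [mul_comm]
      rw [← h3, ← integral_sub _ h2]
      · simp only [hm, max_eq_left hv]
        congr 1; ext ω; ring
      · refine (h1.sub h2).neg.congr (ae_of_all _ fun ω => ?_)
        simp
    have e2 : ∫ v in s..u, ∫ ω in B, q (X (max v 0) ω) ∂μ = c * ∫ v in s..u, m v := by
      rw [← intervalIntegral.integral_const_mul]
      congr 1; ext v
      simp only [hm, hq]
      rw [← integral_const_mul]
      congr 1; ext ω; ring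
    rw [e1 s hs, e1 u (hs.trans hu.1), ← e2]
    linarith

/-- If `L Φ ≤ c Φ` then `exp (-c t) Φ (X t)` is a supermartingale. -/
theorem lintegral_le_of_generator_le (hX : SolvesMartingaleProblem μ F f g x₀ X) {Φ : ℝ → ℝ} {c : ℝ}
    (hΦ : ContDiff ℝ 2 Φ) (hΦ0 : ∀ x, 0 ≤ Φ x)
    (hΦt : Tendsto Φ (cocompact ℝ) atTop) (hc : 0 < c)
    (hgen : ∀ x t, 0 ≤ t → sdeGenerator f g Φ x t ≤ c * Φ x)
    {s t : ℝ} (hs : 0 ≤ s) (hst : s ≤ t) {B : Set Om} (hB : MeasurableSet[F s] B) :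
    ∫⁻ ω in B, ENNReal.ofReal (Φ (X t ω)) ∂μ
      ≤ ENNReal.ofReal (exp (c * (t - s))) * ∫⁻ ω in B, ENNReal.ofReal (Φ (X s ω)) ∂μ := by
  have hpos : ∀ n : ℕ, (0 : ℝ) < n + 1 := fun n => by positivity
  have hlim : ∀ x, Tendsto (fun n : ℕ => ENNReal.ofReal (cutoff (n + 1) Φ x + (n + 1))) atTop
      (nhds (ENNReal.ofReal (3 * Φ x))) := by
    intro x
    refine ENNReal.tendsto_ofReal ?_
    refine tendsto_of_tendsto_of_tendsto_of_le_of_le (g := fun n : ℕ =>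
      3 * Φ x - 3 * (1 / ((n : ℝ) + 1)) * Φ x ^ 2) (h := fun _ => 3 * Φ x) ?_ tendsto_const_nhds ?_ ?_
    · have := ((tendsto_one_div_add_atTop_nhds_zero_nat (𝕜 := ℝ)).const_mul 3).mul_const (Φ x ^ 2)
      simpa using this.const_sub (3 * Φ x)
    · intro n
      have := le_cutoff_add (hpos n) hΦ0 x
      simpa [div_eq_mul_inv] using this
    · intro n
      exact cutoff_add_le (hpos n) hΦ0 x
  have hmeas : ∀ n : ℕ, Measurable fun ω =>
      ENNReal.ofReal (cutoff (n + 1) Φ (X t ω) + (n + 1)) := fun n => by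
    have h1 := (contDiff_cutoff (N := n + 1) hΦ).continuous.measurable
    exact ((h1.comp (hX.measurable t)).add_const _).ennreal_ofReal
  have h1 : ∫⁻ ω in B, ENNReal.ofReal (3 * Φ (X t ω)) ∂μ
      ≤ liminf (fun n : ℕ =>
        ∫⁻ ω in B, ENNReal.ofReal (cutoff (n + 1) Φ (X t ω) + (n + 1)) ∂μ) atTop := by
    refine le_trans (le_of_eq ?_) (lintegral_liminf_le hmeas)
    congr 1; ext ω
    exact (hlim _).liminf_eq.symm
  have h2 : ∀ n : ℕ, ∫⁻ ω in B, ENNReal.ofReal (cutoff (n + 1) Φ (X t ω) + (n + 1)) ∂μ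
      ≤ ENNReal.ofReal (exp (c * (t - s))) * ∫⁻ ω in B, ENNReal.ofReal (3 * Φ (X s ω)) ∂μ := by
    intro n
    have e : ∀ t, ∫⁻ ω in B, ENNReal.ofReal (cutoff (n + 1) Φ (X t ω) + (n + 1)) ∂μ
        = ENNReal.ofReal (∫ ω in B, (cutoff (n + 1) Φ (X t ω) + (n + 1)) ∂μ) := fun t =>
      (ofReal_integral_eq_lintegral_ofReal
        (hX.integrable_cutoff_add (hpos n) hΦ hΦ0 t).integrableOn
        (ae_of_all _ fun ω => cutoff_add_nonneg (hpos n) hΦ0 _)).symm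
    calc _ ≤ ENNReal.ofReal (exp (c * (t - s))) *
          ∫⁻ ω in B, ENNReal.ofReal (cutoff (n + 1) Φ (X s ω) + (n + 1)) ∂μ := by
          rw [e, e, ← ENNReal.ofReal_mul (exp_pos _).le]
          exact ENNReal.ofReal_le_ofReal
            (hX.setIntegral_cutoff_le (hpos n) hΦ hΦ0 hΦt hc hgen hs hst hB)
      _ ≤ _ := by
          gcongr
          exact cutoff_add_le (hpos n) hΦ0 _
  have h3 := h1.trans (liminf_le_of_frequently_le' (Frequently.of_forall h2))
  have e3 : ∀ t, ∫⁻ ω in B, ENNReal.ofReal (3 * Φ (X t ω)) ∂μ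
      = 3 * ∫⁻ ω in B, ENNReal.ofReal (Φ (X t ω)) ∂μ := by
    intro t
    rw [← lintegral_const_mul' _ _ (by norm_num)]
    simp [ENNReal.ofReal_mul]
  rw [e3, e3, mul_left_comm] at h3
  exact (ENNReal.mul_le_mul_iff_right (by norm_num) (by norm_num)).1 h3

theorem integrable_of_generator_le (hX : SolvesMartingaleProblem μ F f g x₀ X) {Φ : ℝ → ℝ} {c : ℝ}
    (hΦ : ContDiff ℝ 2 Φ) (hΦ0 : ∀ x, 0 ≤ Φ x)
    (hΦt : Tendsto Φ (cocompact ℝ) atTop) (hc : 0 < c)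
    (hgen : ∀ x t, 0 ≤ t → sdeGenerator f g Φ x t ≤ c * Φ x) {t : ℝ} (ht : 0 ≤ t) :
    Integrable (fun ω => Φ (X t ω)) μ := by
  refine ⟨(hΦ.continuous.measurable.comp (hX.measurable t)).aestronglyMeasurable, ?_⟩
  rw [hasFiniteIntegral_iff_ofReal (ae_of_all _ fun ω => hΦ0 _)]
  have := hX.lintegral_le_of_generator_le hΦ hΦ0 hΦt hc hgen le_rfl ht MeasurableSet.univ
  simp only [hX.initial, Measure.restrict_univ, lintegral_const, measure_univ, mul_one] at this
  exact this.trans_lt (ENNReal.mul_lt_top ENNReal.ofReal_lt_top ENNReal.ofReal_lt_top)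

theorem setIntegral_le_of_generator_le (hX : SolvesMartingaleProblem μ F f g x₀ X)
    {Φ : ℝ → ℝ} {c : ℝ}
    (hΦ : ContDiff ℝ 2 Φ) (hΦ0 : ∀ x, 0 ≤ Φ x)
    (hΦt : Tendsto Φ (cocompact ℝ) atTop) (hc : 0 < c)
    (hgen : ∀ x t, 0 ≤ t → sdeGenerator f g Φ x t ≤ c * Φ x)
    {s t : ℝ} (hs : 0 ≤ s) (hst : s ≤ t) {B : Set Om} (hB : MeasurableSet[F s] B) :
    ∫ ω in B, Φ (X t ω) ∂μ ≤ exp (c * (t - s)) * ∫ ω in B, Φ (X s ω) ∂μ := by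
  have h := hX.lintegral_le_of_generator_le hΦ hΦ0 hΦt hc hgen hs hst hB
  have hi : ∀ t, 0 ≤ t → Integrable (fun ω => Φ (X t ω)) μ := fun t ht =>
    hX.integrable_of_generator_le hΦ hΦ0 hΦt hc hgen ht
  rw [← ofReal_integral_eq_lintegral_ofReal (hi t (hs.trans hst)).integrableOn
      (ae_of_all _ fun ω => hΦ0 _),
    ← ofReal_integral_eq_lintegral_ofReal (hi s hs).integrableOn (ae_of_all _ fun ω => hΦ0 _),
    ← ENNReal.ofReal_mul (exp_pos _).le] at h
  refine (ENNReal.ofReal_le_ofReal_iff ?_).1 h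
  exact mul_nonneg (exp_pos _).le (integral_nonneg fun ω => hΦ0 _)

/-- If `L Φ ≥ c Φ` then `exp (-c t) Φ (X t)` is a submartingale, provided `Φ ^ 2 + Φ' ^ 2` is
dominated by a function whose expectation along `X` is locally bounded. -/
theorem le_setIntegral_of_le_generator (hX : SolvesMartingaleProblem μ F f g x₀ X)
    {Φ H : ℝ → ℝ} {c M D : ℝ}
    (hΦ : ContDiff ℝ 2 Φ) (hΦ0 : ∀ x, 0 ≤ Φ x)
    (hΦt : Tendsto Φ (cocompact ℝ) atTop) (hc : 0 < c)
    (hgen : ∀ x t, 0 ≤ t → c * Φ x ≤ sdeGenerator f g Φ x t)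
    (hg : ∀ x, g x ^ 2 ≤ M) (hH : ∀ x, Φ x ^ 2 + deriv Φ x ^ 2 ≤ H x)
    {s t : ℝ} (hs : 0 ≤ s) (hst : s ≤ t)
    (hHi : ∀ u ∈ Icc s t, Integrable (fun ω => H (X u ω)) μ)
    (hHD : ∀ u ∈ Icc s t, ∫ ω, H (X u ω) ∂μ ≤ D)
    {B : Set Om} (hB : MeasurableSet[F s] B) :
    exp (c * (t - s)) * ∫ ω in B, Φ (X s ω) ∂μ ≤ ∫ ω in B, Φ (X t ω) ∂μ := by
  have hM : 0 ≤ M := (sq_nonneg _).trans (hg 0)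
  have hH0 : ∀ x, 0 ≤ H x := fun x => le_trans (by positivity) (hH x)
  have hDB : ∀ u ∈ Icc s t, ∫ ω in B, H (X u ω) ∂μ ≤ D := fun u hu =>
    (setIntegral_le_integral (hHi u hu) (ae_of_all _ fun ω => hH0 _)).trans (hHD u hu)
  have hΦi : ∀ u ∈ Icc s t, Integrable (fun ω => Φ (X u ω)) μ := fun u hu => by
    refine ((integrable_const (1 : ℝ)).add (hHi u hu)).mono'
      (hΦ.continuous.measurable.comp (hX.measurable u)).aestronglyMeasurable
      (ae_of_all _ fun ω => ?_)
    rw [Real.norm_of_nonneg (hΦ0 _)]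
    have := hH (X u ω)
    simp only [Pi.add_apply]
    nlinarith [sq_nonneg (Φ (X u ω) - 1), sq_nonneg (deriv Φ (X u ω)), sq_nonneg (Φ (X u ω))]
  have hΦd : Continuous (deriv Φ) := hΦ.continuous_deriv (by norm_num)
  set m : ℝ → ℝ → ℝ := fun N u => ∫ ω in B, (cutoff N Φ (X (max u 0) ω) + N) ∂μ with hm
  have hstep : ∀ N, 0 < N → (m N s - (3 * c + 3 * M) * D * (t - s) / N) * exp (c * (t - s))
      ≤ m N t := by
    intro N hN
    have hcutc : Continuous (cutoff N Φ) := (contDiff_cutoff hΦ).continuous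
    have hfac : Continuous (cutoffFactor N Φ) := continuous_cutoffFactor hΦ.continuous
    set q : ℝ → ℝ := fun x => cutoffFactor N Φ x *
      (3 * cutoffFactor N Φ x * (c * Φ x) - 3 / N * M * deriv Φ x ^ 2) with hq
    have hΦc := hΦ.continuous
    have hqc : Continuous q := by fun_prop
    have hqs : HasCompactSupport q := (hasCompactSupport_cutoffFactor hN hΦt).mul_right
    obtain ⟨C, hqC⟩ := hqs.exists_bound_of_continuous hqc
    have hgq : ∀ x t, 0 ≤ t → q x ≤ sdeGenerator f g (cutoff N Φ) x t := by
      intro x t ht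
      rw [sdeGenerator_cutoff hN hΦ]
      have hw := cutoffFactor_nonneg (N := N) (Φ := Φ) x
      have h2 : 3 * cutoffFactor N Φ x ^ 2 * (c * Φ x)
          ≤ 3 * cutoffFactor N Φ x ^ 2 * sdeGenerator f g Φ x t :=
        mul_le_mul_of_nonneg_left (hgen x t ht) (by positivity)
      have h3 : 3 / N * cutoffFactor N Φ x * deriv Φ x ^ 2 * g x ^ 2
          ≤ 3 / N * cutoffFactor N Φ x * deriv Φ x ^ 2 * M :=
        mul_le_mul_of_nonneg_left (hg x) (by positivity)
      simp only [hq]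
      linarith
    have hql : ∀ x, c * (cutoff N Φ x + N) - (3 * c + 3 * M) / N * H x ≤ q x := by
      intro x
      have h1 := mul_le_mul_of_nonneg_left (cutoff_add_sub_le hN hΦ0 x) hc.le
      have hw := cutoffFactor_nonneg (N := N) (Φ := Φ) x
      have hw1 := cutoffFactor_le_one hN hΦ0 x
      have h2 : 3 / N * M * deriv Φ x ^ 2 * cutoffFactor N Φ x ≤ 3 / N * M * deriv Φ x ^ 2 * 1 :=
        mul_le_mul_of_nonneg_left hw1 (by positivity)
      have h3 : (3 * c) / N * Φ x ^ 2 + (3 * M) / N * deriv Φ x ^ 2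
          ≤ (3 * c + 3 * M) / N * H x := by
        have a1 : Φ x ^ 2 ≤ H x := by nlinarith [hH x, sq_nonneg (deriv Φ x)]
        have a2 : deriv Φ x ^ 2 ≤ H x := by nlinarith [hH x, sq_nonneg (Φ x)]
        have b1 := mul_le_mul_of_nonneg_left a1 (by positivity : 0 ≤ (3 * c) / N)
        have b2 := mul_le_mul_of_nonneg_left a2 (by positivity : 0 ≤ (3 * M) / N)
        have : (3 * c + 3 * M) / N * H x = (3 * c) / N * H x + (3 * M) / N * H x := by ring
        linarith
      have e1 : c * (cutoff N Φ x + N - 3 / N * Φ x ^ 2)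
          = c * (cutoff N Φ x + N) - 3 * c / N * Φ x ^ 2 := by ring
      have e2 : 3 / N * M * deriv Φ x ^ 2 * 1 = 3 * M / N * deriv Φ x ^ 2 := by ring
      simp only [hq]
      nlinarith
    have hmc : Continuous (m N) :=
      hX.continuous_setIntegral (q := fun x => cutoff N Φ x + N) (C := N) (by fun_prop)
        (abs_cutoff_add_le hN hΦ0) B
    refine gronwall_integral_lower (m := m N) hst hc hmc ?_
    intro u hu
    have hu0 := hs.trans hu.1
    have h := hX.setIntegral_add_le (φ := cutoff N Φ) (contDiff_cutoff hΦ)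
      (hasCompactSupport_cutoff hN hΦt) hqc hqC hgq hs hu.1 hB
    have hcuti : ∀ v, Integrable (fun ω => cutoff N Φ (X v ω)) μ := fun v => by
      refine ((hX.integrable_cutoff_add hN hΦ hΦ0 v).sub (integrable_const N)).congr
        (ae_of_all _ fun ω => ?_)
      simp
    have e1 : ∀ v, 0 ≤ v → m N v = ∫ ω in B, cutoff N Φ (X v ω) ∂μ + N * μ.real B := by
      intro v hv
      have h3 : ∫ ω in B, N ∂μ = N * μ.real B := by simp [mul_comm]
      rw [← h3, ← integral_add (hcuti v).integrableOn (integrable_const N).integrableOn]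
      simp only [hm, max_eq_left hv]
    have e2 : c * (∫ v in s..u, m N v) - (3 * c + 3 * M) * D * (t - s) / N
        ≤ ∫ v in s..u, ∫ ω in B, q (X (max v 0) ω) ∂μ := by
      have hD0 : 0 ≤ D := (integral_nonneg fun ω => hH0 _).trans (hHD u hu)
      have h4 : ∫ v in s..u, (c * m N v - (3 * c + 3 * M) / N * D)
          ≤ ∫ v in s..u, ∫ ω in B, q (X (max v 0) ω) ∂μ := by
        refine intervalIntegral.integral_mono_on hu.1
          (((hmc.const_mul c).sub continuous_const).intervalIntegrable _ _)
          ((hX.continuous_setIntegral hqc hqC B).intervalIntegrable _ _) ?_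
        intro v hv
        have hv' : v ∈ Icc s t := ⟨hv.1, hv.2.trans hu.2⟩
        have hv0 := hs.trans hv.1
        simp only [hm, max_eq_left hv0]
        have i1 : IntegrableOn (fun ω => c * (cutoff N Φ (X v ω) + N)) B μ :=
          ((hX.integrable_cutoff_add hN hΦ hΦ0 v).const_mul c).integrableOn
        have i2 : IntegrableOn (fun ω => (3 * c + 3 * M) / N * H (X v ω)) B μ :=
          ((hHi v hv').const_mul _).integrableOn
        have h5 : ∫ ω in B, (c * (cutoff N Φ (X v ω) + N) - (3 * c + 3 * M) / N * H (X v ω)) ∂μ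
            ≤ ∫ ω in B, q (X v ω) ∂μ :=
          integral_mono (i1.sub i2) (hX.integrable_of_bounded hqc hqC v).integrableOn
            fun ω => hql _
        rw [integral_sub i1 i2, integral_const_mul, integral_const_mul] at h5
        have h6 := mul_le_mul_of_nonneg_left (hDB v hv')
          (by positivity : 0 ≤ (3 * c + 3 * M) / N)
        linarith
      rw [intervalIntegral.integral_sub ((hmc.const_mul c).intervalIntegrable _ _)
        (continuous_const.intervalIntegrable _ _), intervalIntegral.integral_const_mul,
        intervalIntegral.integral_const, smul_eq_mul] at h4
      have h7 : (u - s) * ((3 * c + 3 * M) / N * D) ≤ (3 * c + 3 * M) * D * (t - s) / N := by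
        have : (3 * c + 3 * M) * D * (t - s) / N = (t - s) * ((3 * c + 3 * M) / N * D) := by ring
        rw [this]
        exact mul_le_mul_of_nonneg_right (by linarith [hu.2]) (by positivity)
      linarith
    rw [e1 s hs, e1 u hu0]
    linarith
  have hlim : ∀ u ∈ Icc s t, Tendsto (fun n : ℕ => m ((n : ℝ) + 1) u) atTop
      (nhds (3 * ∫ ω in B, Φ (X u ω) ∂μ)) := by
    intro u hu
    have hu0 := hs.trans hu.1
    refine tendsto_of_tendsto_of_tendsto_of_le_of_le (g := fun n : ℕ =>
      3 * (∫ ω in B, Φ (X u ω) ∂μ) - 3 * (1 / ((n : ℝ) + 1)) * D) (h := fun _ => _) ?_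
      tendsto_const_nhds ?_ ?_
    · have := ((tendsto_one_div_add_atTop_nhds_zero_nat (𝕜 := ℝ)).const_mul 3).mul_const D
      simpa using this.const_sub (3 * (∫ ω in B, Φ (X u ω) ∂μ))
    · intro n
      have hN : (0 : ℝ) < n + 1 := by positivity
      have i1 : IntegrableOn (fun ω => 3 * Φ (X u ω)) B μ := ((hΦi u hu).const_mul 3).integrableOn
      have i2 : IntegrableOn (fun ω => 3 * (1 / ((n : ℝ) + 1)) * H (X u ω)) B μ :=
        ((hHi u hu).const_mul _).integrableOn
      have h5 : ∫ ω in B, (3 * Φ (X u ω) - 3 * (1 / ((n : ℝ) + 1)) * H (X u ω)) ∂μ ≤ m (n + 1) u := by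
        simp only [hm, max_eq_left hu0]
        refine integral_mono (i1.sub i2)
          (hX.integrable_cutoff_add hN hΦ hΦ0 u).integrableOn fun ω => ?_
        have := le_cutoff_add hN hΦ0 (X u ω)
        refine le_trans ?_ this
        have a1 : Φ (X u ω) ^ 2 ≤ H (X u ω) := by
          nlinarith [hH (X u ω), sq_nonneg (deriv Φ (X u ω))]
        have := mul_le_mul_of_nonneg_left a1 (by positivity : 0 ≤ 3 / ((n : ℝ) + 1))
        have e : 3 * (1 / ((n : ℝ) + 1)) = 3 / ((n : ℝ) + 1) := by ring
        simp only [e]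
        linarith
      rw [integral_sub i1 i2, integral_const_mul, integral_const_mul] at h5
      have := mul_le_mul_of_nonneg_left (hDB u hu) (by positivity : 0 ≤ 3 * (1 / ((n : ℝ) + 1)))
      simp only
      linarith
    · intro n
      have hN : (0 : ℝ) < n + 1 := by positivity
      simp only [hm, max_eq_left hu0]
      rw [← integral_const_mul]
      exact integral_mono (hX.integrable_cutoff_add hN hΦ hΦ0 u).integrableOn
        ((hΦi u hu).const_mul 3).integrableOn fun ω => cutoff_add_le hN hΦ0 _
  have hl1 := ((hlim s (left_mem_Icc.2 hst)).sub
    ((tendsto_one_div_add_atTop_nhds_zero_nat (𝕜 := ℝ)).const_mul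
      ((3 * c + 3 * M) * D * (t - s)))).mul_const (exp (c * (t - s)))
  have hfin := le_of_tendsto_of_tendsto' hl1 (hlim t (right_mem_Icc.2 hst)) fun n => by
    have := hstep ((n : ℝ) + 1) (by positivity)
    simpa [div_eq_mul_inv] using this
  simp only [mul_zero, sub_zero] at hfin
  linarith

end SolvesMartingaleProblem

theorem eventually_cocompact_exists_abs {p : ℝ → Prop} (h : ∀ᶠ x in cocompact ℝ, p x) :
    ∃ R > 0, ∀ x, R ≤ |x| → p x := by
  rw [_root_.cocompact_eq_atBot_atTop, eventually_sup, eventually_atBot, eventually_atTop] at h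
  obtain ⟨⟨a, ha⟩, b, hb⟩ := h
  refine ⟨max 1 (max (-a) b), by positivity, fun x hx => ?_⟩
  have h1 := (le_max_right _ _).trans hx
  rcases le_abs'.1 h1 with h2 | h2
  · exact ha x (by linarith [le_max_left (-a) b])
  · exact hb x ((le_max_right _ _).trans h2)

theorem exists_forall_sq_le_of_tendsto {g : ℝ → ℝ} {σ : ℝ} (hg : Continuous g)
    (hglim : Tendsto g (cocompact ℝ) (nhds σ)) : ∃ M > 0, ∀ x, g x ^ 2 ≤ M := by
  have h := (hglim.pow 2).eventually_le_const (show σ ^ 2 < σ ^ 2 + 1 by linarith)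
  obtain ⟨R, -, hR⟩ := eventually_cocompact_exists_abs h
  obtain ⟨C, hC⟩ := (isCompact_Icc (a := -R) (b := R)).exists_bound_of_continuousOn
    (hg.pow 2).continuousOn
  refine ⟨max C (σ ^ 2 + 1), by positivity, fun x => ?_⟩
  rcases le_total R |x| with h | h
  · exact (hR x h).trans (le_max_right _ _)
  · have := hC x (abs_le.1 h)
    rw [Real.norm_eq_abs] at this
    exact ((le_abs_self _).trans this).trans (le_max_left _ _)

theorem exists_forall_le_sq_of_continuous {g : ℝ → ℝ} (hg : Continuous g) (hg0 : ∀ x, g x ≠ 0)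
    (R : ℝ) : ∃ m > 0, ∀ x, |x| ≤ R → m ≤ g x ^ 2 := by
  rcases lt_or_ge R 0 with hR | hR
  · exact ⟨1, one_pos, fun x hx => absurd (abs_nonneg x) (by linarith)⟩
  · obtain ⟨x, -, hx⟩ := (isCompact_Icc (a := -R) (b := R)).exists_isMinOn
      ⟨0, by constructor <;> linarith⟩ (hg.pow 2).continuousOn
    exact ⟨g x ^ 2, sq_pos_of_ne_zero (hg0 x), fun y hy => hx (abs_le.1 hy)⟩

/-- The test function `exp √(K² + θ² x²)`, a smooth substitute for `exp (θ |x|)`. -/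
noncomputable def expSqrt (K θ x : ℝ) : ℝ := exp √(K ^ 2 + (θ * x) ^ 2)

theorem expSqrt_nonneg (K θ x : ℝ) : 0 ≤ expSqrt K θ x := (exp_pos _).le

theorem exp_abs_le_expSqrt (K θ x : ℝ) : exp (θ * |x|) ≤ expSqrt K θ x := by
  refine exp_le_exp.2 (Real.le_sqrt_of_sq_le ?_)
  rw [mul_pow, sq_abs, mul_pow]
  nlinarith [sq_nonneg K]

theorem expSqrt_le_exp_abs {K θ : ℝ} (hK : 0 < K) (hθ : 0 < θ) (x : ℝ) :
    expSqrt K θ x ≤ exp (K + θ * |x|) := by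
  refine exp_le_exp.2 ((Real.sqrt_le_left (by positivity)).2 ?_)
  have : (θ * x) ^ 2 = (θ * |x|) ^ 2 := by rw [mul_pow, mul_pow, sq_abs]
  rw [this]
  have : 0 ≤ K * (θ * |x|) := by positivity
  nlinarith

theorem tendsto_const_mul_abs_cocompact {θ : ℝ} (hθ : 0 < θ) :
    Tendsto (fun x : ℝ => θ * |x|) (cocompact ℝ) atTop :=
  (tendsto_norm_cocompact_atTop (E := ℝ)).const_mul_atTop hθ

theorem tendsto_expSqrt {K θ : ℝ} (hθ : 0 < θ) :
    Tendsto (expSqrt K θ) (cocompact ℝ) atTop :=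
  tendsto_atTop_mono (fun x => exp_abs_le_expSqrt K θ x)
    (tendsto_exp_atTop.comp (tendsto_const_mul_abs_cocompact hθ))

theorem contDiff_expSqrt {K θ : ℝ} (hK : 0 < K) : ContDiff ℝ 2 (expSqrt K θ) := by
  unfold expSqrt
  refine ContDiff.exp (ContDiff.sqrt (by fun_prop) fun x => ?_)
  positivity

theorem sdeGenerator_expSqrt_le {f : ℝ → ℝ → ℝ} {g : ℝ → ℝ} {K θ ρ : ℝ} (hK : 0 < K)
    (hρ : ∀ y t : ℝ, 0 ≤ t → y * f y t ≤ ρ) {x t : ℝ} (ht : 0 ≤ t) :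
    sdeGenerator f g (expSqrt K θ) x t ≤
      θ ^ 2 * (ρ / K + 1 / 2 * (g x ^ 2 * ((θ * x) ^ 2 / (K ^ 2 + (θ * x) ^ 2))) +
        1 / 2 * (g x ^ 2 / K)) * expSqrt K θ x := by
  set v : ℝ → ℝ := fun x => √(K ^ 2 + (θ * x) ^ 2) with hv
  have hpos : ∀ x, 0 < K ^ 2 + (θ * x) ^ 2 := fun x => by positivity
  have hvpos : ∀ x, 0 < v x := fun x => Real.sqrt_pos.2 (hpos x)
  have hvsq : ∀ x, v x ^ 2 = K ^ 2 + (θ * x) ^ 2 := fun x => Real.sq_sqrt (hpos x).le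
  have hvK : ∀ x, K ≤ v x := fun x => Real.le_sqrt_of_sq_le (by nlinarith [sq_nonneg (θ * x)])
  have hvd : ∀ x, HasDerivAt v (θ ^ 2 * x / v x) x := by
    intro x
    have h1 : HasDerivAt (fun x => K ^ 2 + (θ * x) ^ 2) (2 * (θ * x) * θ) x := by
      have := (((hasDerivAt_id x).const_mul θ).pow 2).const_add (K ^ 2)
      refine this.congr_deriv ?_
      simp
    refine (h1.sqrt (hpos x).ne').congr_deriv ?_
    have := hvpos x
    simp only [hv] at this ⊢
    field_simp
  have hΦd : ∀ x, HasDerivAt (expSqrt K θ) (expSqrt K θ x * (θ ^ 2 * x / v x)) x := fun x =>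
    (hvd x).exp
  have hd1 : deriv (expSqrt K θ) = fun x => expSqrt K θ x * (θ ^ 2 * x / v x) := by
    ext x; exact (hΦd x).deriv
  have hd2 : deriv (deriv (expSqrt K θ)) x = expSqrt K θ x * (θ ^ 2 * x / v x) * (θ ^ 2 * x / v x) +
      expSqrt K θ x * ((θ ^ 2 * v x - θ ^ 2 * x * (θ ^ 2 * x / v x)) / v x ^ 2) := by
    rw [hd1]
    have h2 : HasDerivAt (fun x => θ ^ 2 * x) (θ ^ 2) x := by
      simpa using (hasDerivAt_id x).const_mul (θ ^ 2)
    exact ((hΦd x).mul (h2.div (hvd x) (hvpos x).ne')).deriv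
  have hρ0 : 0 ≤ ρ := by simpa using hρ 0 0 le_rfl
  have hvx := hvpos x
  have h1 : x * f x t / v x ≤ ρ / K :=
    (div_le_div_of_nonneg_right (hρ x t ht) hvx.le).trans
      (div_le_div_of_nonneg_left hρ0 hK (hvK x))
  have h2 : (v x)⁻¹ ≤ K⁻¹ := inv_anti₀ hK (hvK x)
  have h3 : g x ^ 2 * (v x)⁻¹ ≤ g x ^ 2 * K⁻¹ := mul_le_mul_of_nonneg_left h2 (sq_nonneg _)
  have h4 : 0 ≤ g x ^ 2 * ((θ * x) ^ 2 / v x ^ 3) := by positivity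
  have e : sdeGenerator f g (expSqrt K θ) x t = expSqrt K θ x * (θ ^ 2 *
      (x * f x t / v x + 1 / 2 * (g x ^ 2 * ((θ * x) ^ 2 / v x ^ 2)) +
        1 / 2 * (g x ^ 2 * (v x)⁻¹) - 1 / 2 * (g x ^ 2 * ((θ * x) ^ 2 / v x ^ 3)))) := by
    unfold sdeGenerator
    rw [hd2, hd1]
    field_simp
    ring
  rw [e, mul_comm, ← hvsq, div_eq_mul_inv (g x ^ 2) K]
  refine mul_le_mul_of_nonneg_right (mul_le_mul_of_nonneg_left ?_ (sq_nonneg _))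
    (expSqrt_nonneg _ _ _)
  linarith

/-- For small `θ`, the function `expSqrt K θ` is a supersolution with growth rate `θ² S / 2`. -/
theorem exists_sdeGenerator_expSqrt_le {f : ℝ → ℝ → ℝ} {g : ℝ → ℝ} {σ ρ S : ℝ}
    (hg : Continuous g) (hglim : Tendsto g (cocompact ℝ) (nhds σ))
    (hρ : ∀ y t : ℝ, 0 ≤ t → y * f y t ≤ ρ) (hS : σ ^ 2 < S) :
    ∃ K > 0, ∃ θ₀ > 0, ∀ θ, 0 < θ → θ ≤ θ₀ → ∀ x t, 0 ≤ t →
      sdeGenerator f g (expSqrt K θ) x t ≤ 1 / 2 * θ ^ 2 * S * expSqrt K θ x := by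
  obtain ⟨M, hM0, hM⟩ := exists_forall_sq_le_of_tendsto hg hglim
  obtain ⟨R, hR0, hR⟩ := eventually_cocompact_exists_abs
    ((hglim.pow 2).eventually_le_const (show σ ^ 2 < (σ ^ 2 + S) / 2 by linarith))
  have hρ0 : 0 ≤ ρ := by simpa using hρ 0 0 le_rfl
  have hη : 0 < S - σ ^ 2 := by linarith
  set K := (ρ + M / 2) * 4 / (S - σ ^ 2) with hK
  have hK0 : 0 < K := by positivity
  have hKb : ρ / K + 1 / 2 * (M / K) ≤ (S - σ ^ 2) / 4 := by
    have : ρ / K + 1 / 2 * (M / K) = (S - σ ^ 2) / 4 := by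
      rw [hK]
      have : ρ + M / 2 ≠ 0 := by positivity
      field_simp
    exact this.le
  have hS0 : 0 < S := lt_of_le_of_lt (sq_nonneg _) hS
  refine ⟨K, hK0, K / R * √(S / (2 * M)), by positivity, fun θ hθ hθ0 x t ht => ?_⟩
  refine (sdeGenerator_expSqrt_le hK0 hρ ht).trans ?_
  refine mul_le_mul_of_nonneg_right ?_ (expSqrt_nonneg _ _ _)
  have hθ2 : 0 ≤ θ ^ 2 := sq_nonneg _
  have h1 : g x ^ 2 / K ≤ M / K := div_le_div_of_nonneg_right (hM x) hK0.le
  have h2 : g x ^ 2 * ((θ * x) ^ 2 / (K ^ 2 + (θ * x) ^ 2)) ≤ (σ ^ 2 + S) / 2 := by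
    have hfrac : (θ * x) ^ 2 / (K ^ 2 + (θ * x) ^ 2) ≤ 1 := by
      rw [div_le_one (by positivity)]
      nlinarith [sq_nonneg K]
    rcases le_total R |x| with h | h
    · calc _ ≤ g x ^ 2 * 1 := mul_le_mul_of_nonneg_left hfrac (sq_nonneg _)
        _ ≤ _ := by linarith [hR x h]
    · have hx : (θ * x) ^ 2 ≤ K ^ 2 * (S / (2 * M)) := by
        have a1 : θ * |x| ≤ K / R * √(S / (2 * M)) * R :=
          mul_le_mul hθ0 h (abs_nonneg _) (by positivity)
        have a2 : K / R * √(S / (2 * M)) * R = K * √(S / (2 * M)) := by field_simp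
        rw [a2] at a1
        have a3 := pow_le_pow_left₀ (by positivity) a1 2
        rw [mul_pow, sq_abs, mul_pow K, Real.sq_sqrt (by positivity), ← mul_pow] at a3
        exact a3
      have hfrac2 : (θ * x) ^ 2 / (K ^ 2 + (θ * x) ^ 2) ≤ S / (2 * M) := by
        rw [div_le_iff₀ (by positivity)]
        have : 0 ≤ S / (2 * M) * (θ * x) ^ 2 := by positivity
        linarith
      calc _ ≤ M * (S / (2 * M)) := mul_le_mul (hM x) hfrac2 (by positivity) hM0.le
        _ = S / 2 := by field_simp
        _ ≤ _ := by nlinarith [sq_nonneg σ]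
  have e : 1 / 2 * θ ^ 2 * S = θ ^ 2 * (1 / 2 * S) := by ring
  rw [e]
  exact mul_le_mul_of_nonneg_left (by linarith) hθ2

theorem mul_sinh_nonneg (y : ℝ) : 0 ≤ y * sinh y := by
  rcases le_total 0 y with h | h
  · exact mul_nonneg h (sinh_nonneg_iff.2 h)
  · exact mul_nonneg_of_nonpos_of_nonpos h (sinh_nonpos_iff.2 h)

theorem mul_sinh_le_sq_mul_cosh (y : ℝ) : y * sinh y ≤ y ^ 2 * cosh y := by
  have key : ∀ y : ℝ, 0 ≤ y → sinh y ≤ y * cosh y := by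
    have hd : ∀ y : ℝ, HasDerivAt (fun y => y * cosh y - sinh y)
        (1 * cosh y + y * sinh y - cosh y) y := fun y =>
      ((hasDerivAt_id y).mul (hasDerivAt_cosh y)).sub (hasDerivAt_sinh y)
    have hm : Monotone fun y : ℝ => y * cosh y - sinh y := by
      refine monotone_of_deriv_nonneg (fun y => (hd y).differentiableAt) fun y => ?_
      rw [(hd y).deriv]
      linarith [mul_sinh_nonneg y]
    intro y hy
    have := hm hy
    simp only [sinh_zero, zero_mul, sub_zero] at this
    linarith
  rcases le_total 0 y with h | h
  · nlinarith [key y h]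
  · have := key (-y) (by linarith)
    rw [sinh_neg, cosh_neg] at this
    nlinarith

theorem cosh_le_exp_abs (y : ℝ) : cosh y ≤ exp |y| := by
  rw [← cosh_abs, cosh_eq]
  have : exp (-|y|) ≤ exp |y| := exp_le_exp.2 (by linarith [abs_nonneg y])
  linarith

theorem abs_sinh_le_exp_abs (y : ℝ) : |sinh y| ≤ exp |y| := by
  refine le_trans ?_ (cosh_le_exp_abs y)
  rw [← abs_of_pos (cosh_pos y), ← sq_le_sq, cosh_sq]
  linarith

/-- The test function `cosh (θ x) + (A / 2) θ x sinh (θ x)`. For large `A` it is a subsolution of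
growth rate one for every Bessel generator of positive dimension. -/
noncomputable def coshSinh (A θ x : ℝ) : ℝ := cosh (θ * x) + A / 2 * (θ * x) * sinh (θ * x)

theorem one_le_coshSinh {A : ℝ} (hA : 0 ≤ A) (θ x : ℝ) : 1 ≤ coshSinh A θ x := by
  have h1 := one_le_cosh (θ * x)
  have h2 := mul_nonneg hA (mul_sinh_nonneg (θ * x))
  unfold coshSinh
  nlinarith

theorem coshSinh_le_exp {A κ : ℝ} (hA : 0 ≤ A) (hκ : 0 < κ) {θ : ℝ} (hθ : 0 < θ) (x : ℝ) :
    coshSinh A θ x ≤ (1 + A / κ) * exp ((1 + κ) * (θ * |x|)) := by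
  set y := θ * x with hy
  have hy' : θ * |x| = |y| := by rw [hy, abs_mul, abs_of_pos hθ]
  rw [hy']
  have h1 := cosh_le_exp_abs y
  have h2 : y * sinh y ≤ |y| * exp |y| := by
    refine (le_abs_self _).trans ?_
    rw [abs_mul]
    exact mul_le_mul_of_nonneg_left (abs_sinh_le_exp_abs y) (abs_nonneg y)
  have h3 : 1 ≤ exp (κ * |y|) := one_le_exp (by positivity)
  have h4 : |y| ≤ exp (κ * |y|) / κ := by
    rw [le_div_iff₀ hκ]
    linarith [add_one_le_exp (κ * |y|)]
  have e : exp ((1 + κ) * |y|) = exp |y| * exp (κ * |y|) := by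
    rw [← Real.exp_add]; ring_nf
  have hE := exp_pos |y|
  have h5 : |y| * exp |y| ≤ exp (κ * |y|) / κ * exp |y| := mul_le_mul_of_nonneg_right h4 hE.le
  have h6 : A * (y * sinh y) ≤ A * (exp (κ * |y|) / κ * exp |y|) :=
    mul_le_mul_of_nonneg_left (h2.trans h5) hA
  have h7 : 0 ≤ A * (y * sinh y) := mul_nonneg hA (mul_sinh_nonneg y)
  have h8 : exp |y| * 1 ≤ exp |y| * exp (κ * |y|) := mul_le_mul_of_nonneg_left h3 hE.le
  have e2 : (1 + A / κ) * exp ((1 + κ) * |y|)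
      = exp |y| * exp (κ * |y|) + A * (exp (κ * |y|) / κ * exp |y|) := by rw [e]; ring
  rw [e2]
  change cosh y + A / 2 * y * sinh y ≤ _
  linarith

theorem tendsto_coshSinh {A θ : ℝ} (hA : 0 ≤ A) (hθ : 0 < θ) :
    Tendsto (coshSinh A θ) (cocompact ℝ) atTop := by
  refine tendsto_atTop_mono (f := fun x => θ / 2 * |x|) (fun x => ?_)
    (tendsto_const_mul_abs_cocompact (by positivity))
  have h2 := mul_nonneg hA (mul_sinh_nonneg (θ * x))
  have h3 : θ / 2 * |x| ≤ cosh (θ * x) := by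
    rw [← cosh_abs, cosh_eq, abs_mul, abs_of_pos hθ]
    have := add_one_le_exp (θ * |x|)
    have := exp_pos (-(θ * |x|))
    linarith
  unfold coshSinh
  linarith

theorem contDiff_coshSinh (A θ : ℝ) : ContDiff ℝ 2 (coshSinh A θ) := by
  unfold coshSinh
  exact (contDiff_cosh.comp (by fun_prop)).add
    (ContDiff.mul (by fun_prop) (contDiff_sinh.comp (by fun_prop)))

theorem hasDerivAt_coshSinh (A θ x : ℝ) : HasDerivAt (coshSinh A θ)
    (θ * ((1 + A / 2) * sinh (θ * x) + A / 2 * (θ * x) * cosh (θ * x))) x := by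
  have h0 : HasDerivAt (fun x => θ * x) θ x := by simpa using (hasDerivAt_id x).const_mul θ
  have h1 := h0.cosh.add ((h0.const_mul (A / 2)).mul h0.sinh)
  refine h1.congr_deriv ?_
  ring

theorem deriv_coshSinh (A θ : ℝ) : deriv (coshSinh A θ) = fun x =>
    θ * ((1 + A / 2) * sinh (θ * x) + A / 2 * (θ * x) * cosh (θ * x)) := by
  ext x; exact (hasDerivAt_coshSinh A θ x).deriv

theorem deriv_deriv_coshSinh (A θ x : ℝ) : deriv (deriv (coshSinh A θ)) x =
    θ ^ 2 * (coshSinh A θ x + A * cosh (θ * x)) := by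
  rw [deriv_coshSinh]
  have h0 : HasDerivAt (fun x => θ * x) θ x := by simpa using (hasDerivAt_id x).const_mul θ
  have h1 := ((h0.sinh.const_mul (1 + A / 2)).add
    ((h0.const_mul (A / 2)).mul h0.cosh)).const_mul θ
  refine (h1.congr_deriv ?_).deriv
  unfold coshSinh
  ring

theorem sq_add_deriv_sq_coshSinh_le {A θ : ℝ} (hA : 0 ≤ A) (hθ : 0 < θ) (x : ℝ) :
    coshSinh A θ x ^ 2 + deriv (coshSinh A θ) x ^ 2
      ≤ (1 + A) ^ 2 * (1 + θ ^ 2) * exp (4 * θ * |x|) := by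
  rw [deriv_coshSinh]
  set y := θ * x with hy
  have hy' : 4 * θ * |x| = 2 * |y| + 2 * |y| := by rw [hy, abs_mul, abs_of_pos hθ]; ring
  rw [hy', Real.exp_add]
  set E := exp (2 * |y|) with hE
  have hE1 : 1 ≤ E := one_le_exp (by positivity)
  have hee : E = exp |y| * exp |y| := by rw [hE, ← Real.exp_add]; ring_nf
  have he1 : 1 ≤ exp |y| := one_le_exp (abs_nonneg y)
  have heE : exp |y| ≤ E := by rw [hee]; nlinarith
  have hye : |y| ≤ exp |y| := by linarith [add_one_le_exp |y|]
  have hc : |cosh y| ≤ exp |y| := by rw [abs_of_pos (cosh_pos y)]; exact cosh_le_exp_abs y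
  have hs := abs_sinh_le_exp_abs y
  have hys : |y * sinh y| ≤ E := by
    rw [abs_mul, hee]; exact mul_le_mul hye hs (abs_nonneg _) (by positivity)
  have hyc : |y * cosh y| ≤ E := by
    rw [abs_mul, hee]; exact mul_le_mul hye hc (abs_nonneg _) (by positivity)
  have k1 : |coshSinh A θ x| ≤ (1 + A) * E := by
    have : coshSinh A θ x = cosh y + A / 2 * (y * sinh y) := by
      unfold coshSinh; rw [← hy]; ring
    rw [this]
    refine (abs_add_le _ _).trans ?_
    rw [abs_mul, abs_of_nonneg (by positivity : 0 ≤ A / 2)]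
    have := mul_le_mul_of_nonneg_left hys (by positivity : 0 ≤ A / 2)
    have : 0 ≤ A * E := by positivity
    linarith
  have k2 : |(1 + A / 2) * sinh y + A / 2 * y * cosh y| ≤ (1 + A) * E := by
    rw [mul_assoc]
    refine (abs_add_le _ _).trans ?_
    rw [abs_mul, abs_mul, abs_of_nonneg (by positivity : 0 ≤ A / 2),
      abs_of_nonneg (by positivity : 0 ≤ 1 + A / 2)]
    have a := mul_le_mul_of_nonneg_left hyc (by positivity : 0 ≤ A / 2)
    have b := mul_le_mul_of_nonneg_left (hs.trans heE) (by positivity : 0 ≤ 1 + A / 2)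
    linarith
  have s1 := sq_le_sq' (by linarith [neg_abs_le (coshSinh A θ x)]) ((le_abs_self _).trans k1)
  have s2 := sq_le_sq' (by linarith [neg_abs_le ((1 + A / 2) * sinh y + A / 2 * y * cosh y)])
    ((le_abs_self _).trans k2)
  have s3 := mul_le_mul_of_nonneg_left s2 (sq_nonneg θ)
  simp only
  rw [mul_pow θ]
  linarith

/-- For large `A` and small `θ`, the function `coshSinh A θ` is a subsolution with growth rate
`θ² S / 2`. -/
theorem exists_le_sdeGenerator_coshSinh {f : ℝ → ℝ → ℝ} {g : ℝ → ℝ} {σ mu S : ℝ}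
    (hg : Continuous g) (hg0 : ∀ x, g x ≠ 0) (hglim : Tendsto g (cocompact ℝ) (nhds σ))
    (hmu : ∀ y t : ℝ, 0 ≤ t → mu * g y ^ 2 ≤ y * f y t) (hmu2 : -1 / 2 < mu) (hS0 : 0 < S)
    (hS : S < σ ^ 2) :
    ∃ A > 0, ∃ θ₀ > 0, ∀ θ, 0 < θ → θ ≤ θ₀ → ∀ x t, 0 ≤ t →
      1 / 2 * θ ^ 2 * S * coshSinh A θ x ≤ sdeGenerator f g (coshSinh A θ) x t := by
  obtain ⟨R, hR0, hR⟩ := eventually_cocompact_exists_abs ((hglim.pow 2).eventually_const_le hS)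
  obtain ⟨m, hm0, hm⟩ := exists_forall_le_sq_of_continuous hg hg0 R
  have hmu0 : mu ≤ 0 := by
    have := hmu 0 0 le_rfl
    have := sq_pos_of_ne_zero (hg0 0)
    nlinarith
  have hδ : 0 < 1 + 2 * mu := by linarith
  set A := (1 + 2 * S / m) / (1 + 2 * mu) with hA
  have hA0 : 0 < A := by positivity
  have hAδ : A * (1 + 2 * mu) = 1 + 2 * S / m := by rw [hA]; field_simp
  refine ⟨A, hA0, √(2 / A) / R, by positivity, fun θ hθ hθ0 x t ht => ?_⟩
  set y := θ * x with hy
  have hcosh := cosh_pos y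
  have hψ : coshSinh A θ x = cosh y + A / 2 * (y * sinh y) := by
    unfold coshSinh; rw [← hy]; ring
  have hψ1 : 1 ≤ coshSinh A θ x := one_le_coshSinh hA0.le θ x
  have hdrift : θ ^ 2 * (mu * g x ^ 2) * ((1 + A) * cosh y) ≤ f x t * deriv (coshSinh A θ) x := by
    rw [deriv_coshSinh]
    by_cases hx : x = 0
    · have : θ ^ 2 * (mu * g x ^ 2) * ((1 + A) * cosh y) ≤ 0 := by
        have h1 : mu * g x ^ 2 ≤ 0 := mul_nonpos_of_nonpos_of_nonneg hmu0 (sq_nonneg _)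
        exact mul_nonpos_of_nonpos_of_nonneg
          (mul_nonpos_of_nonneg_of_nonpos (sq_nonneg _) h1) (by positivity)
      simpa [hx] using this
    · set P := (θ * ((1 + A / 2) * sinh (θ * x) + A / 2 * (θ * x) * cosh (θ * x))) / x with hP
      have hx2 : 0 < x ^ 2 := by positivity
      have e : P = ((1 + A / 2) * (y * sinh y) + A / 2 * (y ^ 2 * cosh y)) / x ^ 2 := by
        rw [hP, ← hy]
        rw [hy]
        field_simp
      have hP0 : 0 ≤ P := by
        rw [e]
        have := mul_sinh_nonneg y
        positivity
      have hPle : P ≤ θ ^ 2 * ((1 + A) * cosh y) := by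
        rw [e, div_le_iff₀ hx2]
        have h1 := mul_le_mul_of_nonneg_left (mul_sinh_le_sq_mul_cosh y)
          (by positivity : 0 ≤ 1 + A / 2)
        have : θ ^ 2 * ((1 + A) * cosh y) * x ^ 2 = (1 + A) * (y ^ 2 * cosh y) := by
          rw [hy]; ring
        rw [this]
        linarith
      have e2 : f x t * (θ * ((1 + A / 2) * sinh (θ * x) + A / 2 * (θ * x) * cosh (θ * x)))
          = x * f x t * P := by
        rw [hP]; field_simp
      rw [e2]
      have h2 := mul_le_mul_of_nonneg_right (hmu x t ht) hP0
      have h3 : mu * g x ^ 2 * (θ ^ 2 * ((1 + A) * cosh y)) ≤ mu * g x ^ 2 * P :=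
        mul_le_mul_of_nonpos_left hPle (mul_nonpos_of_nonpos_of_nonneg hmu0 (sq_nonneg _))
      linarith
  have hmain : S * coshSinh A θ x ≤ g x ^ 2 * (coshSinh A θ x + 2 * S / m * cosh y) := by
    rcases le_total R |x| with h | h
    · have h1 := mul_le_mul_of_nonneg_right (hR x h) (by linarith : 0 ≤ coshSinh A θ x)
      have h2 : 0 ≤ g x ^ 2 * (2 * S / m * cosh y) := by positivity
      linarith
    · have hy2 : A * y ^ 2 ≤ 2 := by
        have a1 : θ * |x| ≤ √(2 / A) / R * R :=
          mul_le_mul hθ0 h (abs_nonneg _) (by positivity)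
        rw [div_mul_cancel₀ _ hR0.ne'] at a1
        have a3 := pow_le_pow_left₀ (by positivity) a1 2
        rw [mul_pow, sq_abs, Real.sq_sqrt (by positivity), ← mul_pow, le_div_iff₀ hA0] at a3
        linarith
      have h1 : coshSinh A θ x ≤ 2 * cosh y := by
        rw [hψ]
        have := mul_sinh_le_sq_mul_cosh y
        nlinarith
      have h2 : m * (2 * S / m * cosh y) ≤ g x ^ 2 * (2 * S / m * cosh y) :=
        mul_le_mul_of_nonneg_right (hm x h) (by positivity)
      have e : m * (2 * S / m * cosh y) = S * (2 * cosh y) := by field_simp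
      have h3 := mul_le_mul_of_nonneg_left h1 hS0.le
      have h4 : 0 ≤ g x ^ 2 * coshSinh A θ x := by positivity
      linarith
  have hη : 2 * S / m ≤ A + 2 * mu * (1 + A) := by linarith
  have h5 : g x ^ 2 * (2 * S / m * cosh y) ≤ g x ^ 2 * ((A + 2 * mu * (1 + A)) * cosh y) := by
    gcongr
  have h6 : θ ^ 2 * (S * coshSinh A θ x)
      ≤ θ ^ 2 * (g x ^ 2 * (coshSinh A θ x + (A + 2 * mu * (1 + A)) * cosh y)) :=
    mul_le_mul_of_nonneg_left (by linarith) (sq_nonneg θ)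
  unfold sdeGenerator
  rw [deriv_deriv_coshSinh, ← hy]
  linarith

/-- Doob's maximal inequality for nonnegative supermartingales indexed by `ℕ`. -/
theorem mul_measure_exists_le_le_lintegral {Om : Type*} {m0 : MeasurableSpace Om} {μ : Measure Om}
    {𝒢 : Filtration ℕ m0} {W : ℕ → Om → ENNReal} (hW : ∀ k, Measurable[𝒢 k] (W k))
    (hsuper : ∀ k B, MeasurableSet[𝒢 k] B → ∫⁻ ω in B, W (k + 1) ω ∂μ ≤ ∫⁻ ω in B, W k ω ∂μ)
    (l : ENNReal) (N : ℕ) :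
    l * μ {ω | ∃ k ≤ N, l ≤ W k ω} ≤ ∫⁻ ω, W 0 ω ∂μ := by
  have hA : ∀ k, MeasurableSet[𝒢 k] {ω | l ≤ W k ω} := fun k =>
    hW k measurableSet_Ici
  have hE : ∀ n, MeasurableSet[𝒢 n] {ω | ∃ k ≤ n, l ≤ W k ω} := fun n => by
    have : {ω | ∃ k ≤ n, l ≤ W k ω} = ⋃ k ∈ Iic n, {ω | l ≤ W k ω} := by ext; simp
    rw [this]
    exact @MeasurableSet.biUnion _ _ (𝒢 n) _ _ (to_countable _) fun k hk => 𝒢.mono hk _ (hA k)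
  have key : ∀ n, l * μ {ω | ∃ k ≤ n, l ≤ W k ω} +
      ∫⁻ ω in {ω | ∃ k ≤ n, l ≤ W k ω}ᶜ, W n ω ∂μ ≤ ∫⁻ ω, W 0 ω ∂μ := by
    intro n
    induction n with
    | zero =>
      have h0 : {ω | ∃ k ≤ 0, l ≤ W k ω} = {ω | l ≤ W 0 ω} := by ext; simp
      rw [h0, ← lintegral_add_compl (μ := μ) (W 0) (𝒢.le 0 _ (hA 0))]
      gcongr
      rw [← setLIntegral_const]
      exact setLIntegral_mono' (𝒢.le 0 _ (hA 0)) fun ω hω => hω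
    | succ n ih =>
      have h1 : {ω | ∃ k ≤ n + 1, l ≤ W k ω} =
          {ω | ∃ k ≤ n, l ≤ W k ω} ∪ ({ω | ∃ k ≤ n, l ≤ W k ω}ᶜ ∩ {ω | l ≤ W (n + 1) ω}) := by
        ext ω
        simp only [mem_ofPred_eq, mem_union, mem_inter_iff, mem_compl_iff, Nat.le_succ_iff]
        constructor
        · rintro ⟨k, hk | rfl, h⟩
          · exact Or.inl ⟨k, hk, h⟩
          · by_cases h' : ∃ k ≤ n, l ≤ W k ω
            · exact Or.inl h'
            · exact Or.inr ⟨h', h⟩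
        · rintro (⟨k, hk, h⟩ | ⟨-, h⟩)
          · exact ⟨k, Or.inl hk, h⟩
          · exact ⟨_, Or.inr rfl, h⟩
      have h2 : {ω | ∃ k ≤ n + 1, l ≤ W k ω}ᶜ =
          {ω | ∃ k ≤ n, l ≤ W k ω}ᶜ \ {ω | l ≤ W (n + 1) ω} := by
        rw [h1, compl_union, compl_inter, compl_compl, inter_union_distrib_left, compl_inter_self,
          empty_union, Set.sdiff_eq]
      have hm := 𝒢.le (n + 1) _ (hA (n + 1))
      calc l * μ {ω | ∃ k ≤ n + 1, l ≤ W k ω} +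
            ∫⁻ ω in {ω | ∃ k ≤ n + 1, l ≤ W k ω}ᶜ, W (n + 1) ω ∂μ
          ≤ (l * μ {ω | ∃ k ≤ n, l ≤ W k ω} +
              ∫⁻ ω in {ω | ∃ k ≤ n, l ≤ W k ω}ᶜ ∩ {ω | l ≤ W (n + 1) ω}, W (n + 1) ω ∂μ) +
            ∫⁻ ω in {ω | ∃ k ≤ n, l ≤ W k ω}ᶜ \ {ω | l ≤ W (n + 1) ω}, W (n + 1) ω ∂μ := by
            rw [h2]
            gcongr
            rw [h1]
            refine (mul_le_mul_right (measure_union_le _ _) _).trans ?_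
            rw [mul_add]
            gcongr
            rw [← setLIntegral_const]
            exact setLIntegral_mono' ((𝒢.le n _ (hE n)).compl.inter hm) fun ω hω => hω.2
        _ = l * μ {ω | ∃ k ≤ n, l ≤ W k ω} +
              ∫⁻ ω in {ω | ∃ k ≤ n, l ≤ W k ω}ᶜ, W (n + 1) ω ∂μ := by
            rw [add_assoc, lintegral_inter_add_sdiff _ _ hm]
        _ ≤ l * μ {ω | ∃ k ≤ n, l ≤ W k ω} +
              ∫⁻ ω in {ω | ∃ k ≤ n, l ≤ W k ω}ᶜ, W n ω ∂μ := by
            gcongr 1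
            exact hsuper n _ (MeasurableSet.compl (hE n))
        _ ≤ ∫⁻ ω, W 0 ω ∂μ := ih
  exact le_self_add.trans (key N)

namespace SolvesMartingaleProblem

variable {Om : Type*} {m0 : MeasurableSpace Om} {μ : Measure Om} [IsProbabilityMeasure μ]
  {F : Filtration ℝ m0} {f : ℝ → ℝ → ℝ} {g : ℝ → ℝ} {x₀ : ℝ} {X : ℝ → Om → ℝ}

/-- Maximal inequality along a regular grid. -/
theorem mul_measure_exists_grid_le (hX : SolvesMartingaleProblem μ F f g x₀ X) {Φ : ℝ → ℝ}
    {c : ℝ} (hΦ : ContDiff ℝ 2 Φ) (hΦ0 : ∀ x, 0 ≤ Φ x)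
    (hΦt : Tendsto Φ (cocompact ℝ) atTop) (hc : 0 < c)
    (hgen : ∀ x t, 0 ≤ t → sdeGenerator f g Φ x t ≤ c * Φ x)
    {δ l : ℝ} (hδ : 0 ≤ δ) (hl : 0 ≤ l) (N : ℕ) :
    ENNReal.ofReal l * μ {ω | ∃ k ≤ N, l ≤ Φ (X (k * δ) ω)} ≤
      ENNReal.ofReal (exp (c * (N * δ)) * Φ x₀) := by
  let 𝒢 : Filtration ℕ m0 :=
    { seq := fun k => F (k * δ)
      mono' := fun i j hij => F.mono (by gcongr)
      le' := fun k => F.le _ }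
  set W : ℕ → Om → ENNReal := fun k ω => ENNReal.ofReal (exp (-(c * (k * δ))) * Φ (X (k * δ) ω))
    with hWdef
  have hW : ∀ k, Measurable[𝒢 k] (W k) := fun k =>
    ENNReal.measurable_ofReal.comp
      ((hΦ.continuous.measurable.comp (hX.adapted (k * δ))).const_mul _)
  have hWeq : ∀ k B, ∫⁻ ω in B, W k ω ∂μ = ENNReal.ofReal (exp (-(c * (k * δ)))) *
      ∫⁻ ω in B, ENNReal.ofReal (Φ (X (k * δ) ω)) ∂μ := fun k B => by
    rw [← lintegral_const_mul']
    · simp only [hWdef, ENNReal.ofReal_mul (exp_pos _).le]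
    · exact ENNReal.ofReal_ne_top
  have hsuper : ∀ k B, MeasurableSet[𝒢 k] B →
      ∫⁻ ω in B, W (k + 1) ω ∂μ ≤ ∫⁻ ω in B, W k ω ∂μ := fun k B hB => by
    have h := hX.lintegral_le_of_generator_le hΦ hΦ0 hΦt hc hgen (s := k * δ)
      (t := (k + 1 : ℕ) * δ) (by positivity) (by push_cast; nlinarith) hB
    rw [hWeq, hWeq]
    refine (mul_le_mul_right h _).trans_eq ?_
    rw [← mul_assoc, ← ENNReal.ofReal_mul (exp_pos _).le, ← Real.exp_add]
    congr 3
    push_cast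
    ring
  have h0 : ∫⁻ ω, W 0 ω ∂μ = ENNReal.ofReal (Φ x₀) := by
    simp [hWdef, hX.initial]
  have h := mul_measure_exists_le_le_lintegral hW hsuper
    (ENNReal.ofReal (exp (-(c * (N * δ))) * l)) N
  have hsub : {ω | ∃ k ≤ N, l ≤ Φ (X (k * δ) ω)} ⊆
      {ω | ∃ k ≤ N, ENNReal.ofReal (exp (-(c * (N * δ))) * l) ≤ W k ω} := by
    rintro ω ⟨k, hk, h⟩
    refine ⟨k, hk, ENNReal.ofReal_le_ofReal (mul_le_mul (exp_le_exp.2 ?_) h hl (exp_pos _).le)⟩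
    gcongr
  rw [h0] at h
  calc ENNReal.ofReal l * μ {ω | ∃ k ≤ N, l ≤ Φ (X (k * δ) ω)}
      = ENNReal.ofReal (exp (c * (N * δ))) * (ENNReal.ofReal (exp (-(c * (N * δ))) * l) *
          μ {ω | ∃ k ≤ N, l ≤ Φ (X (k * δ) ω)}) := by
        rw [← mul_assoc, ← ENNReal.ofReal_mul (exp_pos _).le, ← mul_assoc, ← Real.exp_add]
        simp
    _ ≤ ENNReal.ofReal (exp (c * (N * δ))) * ENNReal.ofReal (Φ x₀) := by
        gcongr
        exact (mul_le_mul_right (measure_mono hsub) _).trans h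
    _ = _ := (ENNReal.ofReal_mul (exp_pos _).le).symm

/-- Maximal inequality in continuous time. -/
theorem mul_measure_exists_lt_le (hX : SolvesMartingaleProblem μ F f g x₀ X) {Φ : ℝ → ℝ}
    {c : ℝ} (hΦ : ContDiff ℝ 2 Φ) (hΦ0 : ∀ x, 0 ≤ Φ x)
    (hΦt : Tendsto Φ (cocompact ℝ) atTop) (hc : 0 < c)
    (hgen : ∀ x t, 0 ≤ t → sdeGenerator f g Φ x t ≤ c * Φ x)
    {T l : ℝ} (hT : 0 < T) (hl : 0 ≤ l) :
    ENNReal.ofReal l * μ {ω | ∃ t ∈ Icc 0 T, l < Φ (X t ω)} ≤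
      ENNReal.ofReal (exp (c * T) * Φ x₀) := by
  set E : ℕ → Set Om := fun j =>
    {ω | ∃ k ≤ j + 1, l ≤ Φ (X (k * (T / (j + 1 : ℕ))) ω)} with hEdef
  have hE : ∀ j, ENNReal.ofReal l * μ (E j) ≤ ENNReal.ofReal (exp (c * T) * Φ x₀) := fun j => by
    have h := hX.mul_measure_exists_grid_le hΦ hΦ0 hΦt hc hgen (δ := T / (j + 1 : ℕ))
      (by positivity) hl (j + 1)
    rwa [mul_div_cancel₀ T (by positivity)] at h
  set I : ℕ → Set Om := fun n => ⋂ j ≥ n, E j with hI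
  have hmono : Monotone I := fun m n hmn =>
    biInter_subset_biInter_left fun j (hj : n ≤ j) => hmn.trans hj
  have hsub : {ω | ∃ t ∈ Icc 0 T, l < Φ (X t ω)} ⊆ ⋃ n, I n := by
    rintro ω ⟨t, ht, hlt⟩
    have hcont : ContinuousWithinAt (fun t => Φ (X t ω)) (Ici 0) t :=
      hΦ.continuous.continuousAt.comp_continuousWithinAt (hX.continuousOn_path ω t ht.1)
    have hlim : Tendsto (fun j : ℕ => ⌊t / T * (j + 1 : ℕ)⌋₊ * (T / (j + 1 : ℕ))) atTop
        (nhdsWithin t (Ici 0)) := by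
      refine tendsto_nhdsWithin_iff.2 ⟨?_, .of_forall fun j => mem_Ici.2 (by positivity)⟩
      have h := ((tendsto_nat_floor_mul_div_atTop (R := ℝ) (a := t / T)
        (div_nonneg ht.1 hT.le)).comp (tendsto_natCast_atTop_atTop.comp
        (tendsto_add_atTop_nat 1))).mul_const T
      rw [div_mul_cancel₀ _ hT.ne'] at h
      refine h.congr fun j => ?_
      simp only [Function.comp_apply]
      ring
    obtain ⟨n, hn⟩ := eventually_atTop.1 (hlim.eventually (hcont.eventually_const_lt hlt))
    refine mem_iUnion.2 ⟨n, mem_iInter₂.2 fun j hj => ⟨_, ?_, (hn j hj).le⟩⟩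
    refine Nat.floor_le_of_le ?_
    exact mul_le_of_le_one_left (by positivity) ((div_le_one hT).2 ht.2)
  calc ENNReal.ofReal l * μ {ω | ∃ t ∈ Icc 0 T, l < Φ (X t ω)}
      ≤ ENNReal.ofReal l * μ (⋃ n, I n) := by gcongr
    _ = ⨆ n, ENNReal.ofReal l * μ (I n) := by rw [hmono.measure_iUnion, ENNReal.mul_iSup]
    _ ≤ _ := iSup_le fun n =>
        (mul_le_mul_right (measure_mono (biInter_subset_of_mem (le_refl n))) _).trans (hE n)

end SolvesMartingaleProblem

theorem tendsto_log_log_atTop : Tendsto (fun t : ℝ => log (log t)) atTop atTop :=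
  tendsto_log_atTop.comp tendsto_log_atTop

theorem tendsto_sqrt_log_log_div_atTop (b : ℝ) :
    Tendsto (fun t : ℝ => b * √(2 * log (log t) / t)) atTop (nhds 0) := by
  have h1 : (fun t : ℝ => log (log t)) =o[atTop] fun t => t :=
    (isLittleO_log_id_atTop.comp_tendsto tendsto_log_atTop).trans isLittleO_log_id_atTop
  have h2 := (h1.tendsto_div_nhds_zero.const_mul 2).sqrt.const_mul b
  simpa [mul_div_assoc] using h2

theorem summable_exp_neg_mul_log_log_pow_iff {q p : ℝ} (hq : 1 < q) :
    Summable (fun n : ℕ => exp (-(p * log (log (q ^ n))))) ↔ 1 < p := by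
  have hq' := Real.log_pos hq
  have h : ∀ n : ℕ, exp (-(p * log (log (q ^ (n + 1))))) =
      exp (-(p * log (log q))) * ((n + 1 : ℕ) : ℝ) ^ (-p) := fun n => by
    have hn : (0 : ℝ) < (n + 1 : ℕ) := by positivity
    rw [Real.rpow_def_of_pos hn, ← Real.exp_add, Real.log_pow, Real.log_mul hn.ne' hq'.ne']
    congr 1
    ring
  rw [← summable_nat_add_iff 1]
  simp_rw [h]
  rw [summable_mul_left_iff (exp_pos _).ne',
    summable_nat_add_iff (f := fun n : ℕ => (n : ℝ) ^ (-p)) 1, Real.summable_nat_rpow, neg_lt_neg_iff]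

theorem sqrt_mul_log_log_le_sqrt {s t : ℝ} (hs : exp 1 ≤ s) (hst : s ≤ t) :
    √(2 * s * log (log s)) ≤ √(2 * t * log (log t)) := by
  have hs0 := (exp_pos 1).trans_le hs
  have h1 : 1 ≤ log s := (Real.le_log_iff_exp_le hs0).2 hs
  have h2 : log s ≤ log t := Real.log_le_log hs0 hst
  have h3 : log (log s) ≤ log (log t) := Real.log_le_log (by linarith) h2
  have h4 := Real.log_nonneg h1
  have ht0 := hs0.trans_le hst
  gcongr

namespace SolvesMartingaleProblem

variable {Om : Type*} {m0 : MeasurableSpace Om} {μ : Measure Om} [IsProbabilityMeasure μ]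
  {F : Filtration ℝ m0} {f : ℝ → ℝ → ℝ} {g : ℝ → ℝ} {x₀ : ℝ} {X : ℝ → Om → ℝ}

theorem measure_exists_lt_abs_le (hX : SolvesMartingaleProblem μ F f g x₀ X) {K θ S : ℝ}
    (hK : 0 < K) (hθ : 0 < θ) (hS : 0 < S)
    (hgen : ∀ x t, 0 ≤ t →
      sdeGenerator f g (expSqrt K θ) x t ≤ 1 / 2 * θ ^ 2 * S * expSqrt K θ x)
    {T a : ℝ} (hT : 0 < T) :
    μ {ω | ∃ t ∈ Icc 0 T, a < |X t ω|} ≤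
      ENNReal.ofReal (exp (1 / 2 * θ ^ 2 * S * T - θ * a + (K + θ * |x₀|))) := by
  have h := hX.mul_measure_exists_lt_le (contDiff_expSqrt hK) (expSqrt_nonneg K θ)
    (tendsto_expSqrt hθ) (c := 1 / 2 * θ ^ 2 * S) (by positivity) hgen hT (exp_pos (θ * a)).le
  have hsub : {ω | ∃ t ∈ Icc 0 T, a < |X t ω|} ⊆
      {ω | ∃ t ∈ Icc 0 T, exp (θ * a) < expSqrt K θ (X t ω)} := by
    rintro ω ⟨t, ht, hlt⟩
    exact ⟨t, ht, (exp_lt_exp.2 (by gcongr)).trans_le (exp_abs_le_expSqrt K θ _)⟩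
  calc μ {ω | ∃ t ∈ Icc 0 T, a < |X t ω|}
      ≤ μ {ω | ∃ t ∈ Icc 0 T, exp (θ * a) < expSqrt K θ (X t ω)} := measure_mono hsub
    _ = ENNReal.ofReal (exp (-(θ * a))) * (ENNReal.ofReal (exp (θ * a)) *
          μ {ω | ∃ t ∈ Icc 0 T, exp (θ * a) < expSqrt K θ (X t ω)}) := by
        rw [← mul_assoc, ← ENNReal.ofReal_mul (exp_pos _).le, ← Real.exp_add]
        simp
    _ ≤ ENNReal.ofReal (exp (-(θ * a))) *
          ENNReal.ofReal (exp (1 / 2 * θ ^ 2 * S * T) * exp (K + θ * |x₀|)) := by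
        gcongr
        refine h.trans (ENNReal.ofReal_le_ofReal ?_)
        gcongr
        exact expSqrt_le_exp_abs hK hθ x₀
    _ = _ := by
        rw [← ENNReal.ofReal_mul (exp_pos _).le, ← Real.exp_add, ← Real.exp_add]
        congr 2
        ring

/-- The upper bound in the law of the iterated logarithm. -/
theorem ae_eventually_abs_le (hX : SolvesMartingaleProblem μ F f g x₀ X) {σ ρ r : ℝ}
    (hglim : Tendsto g (cocompact ℝ) (nhds σ)) (hρ : ∀ y t : ℝ, 0 ≤ t → y * f y t ≤ ρ)
    (hr : |σ| < r) :
    ∀ᵐ ω ∂μ, ∀ᶠ t in atTop, |X t ω| ≤ r * √(2 * t * log (log t)) := by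
  have hr0 : 0 < r := (abs_nonneg σ).trans_lt hr
  have hr2 : σ ^ 2 < r ^ 2 := by rw [← sq_abs σ]; gcongr
  obtain ⟨S, hS1, hS2⟩ := exists_between hr2
  have hS0 : 0 < S := (sq_nonneg σ).trans_lt hS1
  obtain ⟨q, hq1, hq2⟩ := exists_between ((one_lt_div hS0).2 hS2)
  have hq0 : 0 < q := one_pos.trans hq1
  set p : ℝ := r ^ 2 / (S * q) with hp
  have hp1 : 1 < p := by
    rw [hp, one_lt_div (by positivity), mul_comm]
    exact (lt_div_iff₀ hS0).1 hq2
  obtain ⟨K, hK, θ₀, hθ₀, hgen⟩ :=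
    exists_sdeGenerator_expSqrt_le hX.continuous_diffusion hglim hρ hS1
  set b : ℝ := r / (S * q) with hb
  have hpow : Tendsto (fun n : ℕ => q ^ n) atTop atTop := tendsto_pow_atTop_atTop_of_one_lt hq1
  have hθlim := (tendsto_sqrt_log_log_div_atTop b).comp hpow
  have hev : ∀ᶠ n : ℕ in atTop, exp 1 < q ^ n ∧ 0 < log (log (q ^ n)) ∧
      b * √(2 * log (log (q ^ n)) / q ^ n) < θ₀ ∧ b * √(2 * log (log (q ^ n)) / q ^ n) < 1 := by
    filter_upwards [hpow.eventually_gt_atTop (exp 1),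
      (tendsto_log_log_atTop.comp hpow).eventually_gt_atTop 0, hθlim.eventually_lt_const hθ₀,
      hθlim.eventually_lt_const one_pos] with n h1 h2 h3 h4 using ⟨h1, h2, h3, h4⟩
  obtain ⟨n₀, hn₀⟩ := eventually_atTop.1 hev
  set E : ℕ → Set Om := fun n =>
    {ω | ∃ t ∈ Icc 0 (q ^ (n + 1)), r * √(2 * q ^ n * log (log (q ^ n))) < |X t ω|} with hE
  have hbound : ∀ n ≥ n₀, μ (E n) ≤
      ENNReal.ofReal (exp (-(p * log (log (q ^ n)))) * exp (K + |x₀|)) := fun n hn => by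
    obtain ⟨-, hL, h3, h4⟩ := hn₀ n hn
    set L := log (log (q ^ n))
    set θ := b * √(2 * L / q ^ n) with hθ
    have hqn : 0 < q ^ n := by positivity
    have hθ0 : 0 < θ := by positivity
    refine (hX.measure_exists_lt_abs_le hK hθ0 hS0 (hgen θ hθ0 h3.le)
      (by positivity)).trans (ENNReal.ofReal_le_ofReal ?_)
    rw [← Real.exp_add]
    refine exp_le_exp.2 (add_le_add (le_of_eq ?_) ?_)
    · have e1 : θ ^ 2 = b ^ 2 * (2 * L / q ^ n) := by
        rw [hθ, mul_pow, Real.sq_sqrt (by positivity)]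
      have e2 : θ * (r * √(2 * q ^ n * L)) = b * r * (2 * L) := by
        have : √(2 * L / q ^ n) * √(2 * q ^ n * L) = 2 * L := by
          rw [← Real.sqrt_mul (by positivity)]
          rw [show 2 * L / q ^ n * (2 * q ^ n * L) = (2 * L) ^ 2 by field_simp]
          exact Real.sqrt_sq (by positivity)
        rw [hθ]; linear_combination b * r * this
      rw [e1, e2, hp, hb, pow_succ]
      field_simp
      ring
    · have := mul_le_of_le_one_left (abs_nonneg x₀) h4.le
      linarith
  have hsum : ∑' n, μ (E (n + n₀)) ≠ ⊤ := by
    have h := ((summable_nat_add_iff n₀).2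
      ((summable_exp_neg_mul_log_log_pow_iff (p := p) hq1).2 hp1)).mul_right (exp (K + |x₀|))
    refine ne_top_of_le_ne_top h.tsum_ofReal_ne_top (ENNReal.tsum_le_tsum fun n => ?_)
    exact hbound _ (Nat.le_add_left _ _)
  filter_upwards [ae_eventually_notMem hsum] with ω hω
  obtain ⟨n₁, hn₁⟩ := eventually_atTop.1 hω
  filter_upwards [eventually_ge_atTop (q ^ (n₁ + n₀)), eventually_ge_atTop 1] with t ht ht1
  obtain ⟨n, hn, hn'⟩ := exists_nat_pow_near ht1 hq1
  have hle : n₁ + n₀ ≤ n := Nat.lt_succ_iff.1 ((pow_lt_pow_iff_right₀ hq1).1 (ht.trans_lt hn'))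
  have h := hn₁ (n - n₀) (by omega)
  rw [Nat.sub_add_cancel (by omega)] at h
  have h' : |X t ω| ≤ r * √(2 * q ^ n * log (log (q ^ n))) := by
    by_contra! hcon
    exact h ⟨t, ⟨by linarith, hn'.le⟩, hcon⟩
  refine h'.trans ?_
  gcongr ?_ * ?_
  exact sqrt_mul_log_log_le_sqrt (hn₀ n (by omega)).1.le hn

end SolvesMartingaleProblem

/-- For small `z` the exponents of the second moment argument are ordered as in the limit. -/
theorem exists_exponents_lt {η : ℝ} (hη : 0 < η) :
    ∃ z, 0 < z ∧ z < 1 ∧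
      ((1 - 2 * η) * (1 + z) - η) ^ 2 * (1 + z) + 4 * ((1 - 2 * η) * (1 + z) - η) * z
          + 2 * η * (1 - 3 * η) < (1 - 2 * η) ^ 2 * (1 - z) * (1 - z ^ 2) ∧
      ((1 - 2 * η) * (1 + z) + η) ^ 2 * (1 + z) + 4 * ((1 - 2 * η) * (1 + z) + η) * z
          - 2 * η * (1 - η) < (1 - 2 * η) ^ 2 * (1 - z) * (1 - z ^ 2) ∧
      2 * (1 - 2 * η) * (1 + z) * (1 - η) - (1 - 2 * η) ^ 2 * (1 - z) * (1 - z ^ 2) < 1 := by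
  have key : ∀ φ ψ : ℝ → ℝ, Continuous φ → Continuous ψ → φ 0 < ψ 0 →
      ∀ᶠ z in nhdsWithin (0 : ℝ) (Ioi 0), φ z < ψ z := fun φ ψ hφ hψ h =>
    eventually_nhdsWithin_of_eventually_nhds (hφ.continuousAt.eventually_lt hψ.continuousAt h)
  have h1 := key (fun z => ((1 - 2 * η) * (1 + z) - η) ^ 2 * (1 + z) +
    4 * ((1 - 2 * η) * (1 + z) - η) * z + 2 * η * (1 - 3 * η))
    (fun z => (1 - 2 * η) ^ 2 * (1 - z) * (1 - z ^ 2)) (by fun_prop) (by fun_prop) (by nlinarith)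
  have h2 := key (fun z => ((1 - 2 * η) * (1 + z) + η) ^ 2 * (1 + z) +
    4 * ((1 - 2 * η) * (1 + z) + η) * z - 2 * η * (1 - η))
    (fun z => (1 - 2 * η) ^ 2 * (1 - z) * (1 - z ^ 2)) (by fun_prop) (by fun_prop) (by nlinarith)
  have h3 := key (fun z => 2 * (1 - 2 * η) * (1 + z) * (1 - η) -
    (1 - 2 * η) ^ 2 * (1 - z) * (1 - z ^ 2)) (fun _ => 1) (by fun_prop) (by fun_prop)
    (by nlinarith)
  obtain ⟨z, hz, hz0, g1, g2, g3⟩ :=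
    ((key (fun z => z) (fun _ => 1) continuous_id continuous_const one_pos).and
      (eventually_mem_nhdsWithin.and (h1.and (h2.and h3)))).exists
  exact ⟨z, hz0, hz, g1, g2, g3⟩

theorem eventually_mul_exp_add_exp_le {E₀ E₁ E₂ : ℝ} (h1 : E₁ < E₀) (h2 : E₂ < E₀) (C K : ℝ) :
    ∀ᶠ L in atTop, C * (exp (K + L * E₁) + exp (K + L * E₂)) ≤ 1 / 2 * exp (L * E₀) := by
  have key : ∀ E, E < E₀ → Tendsto (fun L => C * exp (K + L * (E - E₀))) atTop (nhds 0) :=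
    fun E hE => by
      have : Tendsto (fun L => exp (K + L * (E - E₀))) atTop (nhds 0) :=
        tendsto_exp_atBot.comp (tendsto_atBot_add_const_left _ _
          (tendsto_id.atTop_mul_const_of_neg (by linarith)))
      simpa using this.const_mul C
  filter_upwards [((key E₁ h1).add (key E₂ h2)).eventually_le_const
    (show (0 : ℝ) + 0 < 1 / 2 by norm_num)] with L hL
  have e : ∀ E, exp (K + L * E) = exp (K + L * (E - E₀)) * exp (L * E₀) := fun E => by
    rw [← Real.exp_add]; congr 1; ring
  rw [e E₁, e E₂, ← add_mul, ← mul_assoc, mul_add]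
  gcongr

/-- Localisation of an exponential around the interval `[m, M]`. -/
theorem exp_mul_le_add_indicator {b d : ℝ} (hb : 0 ≤ b) (hd : 0 ≤ d) (m M y : ℝ) :
    exp (b * y) ≤ exp (d * m) * exp ((b - d) * y) + exp (-(d * M)) * exp ((b + d) * y) +
      exp (b * M) * (Ici m).indicator 1 y := by
  have h3 : 0 ≤ exp (b * M) * (Ici m).indicator 1 y :=
    mul_nonneg (exp_pos _).le (indicator_nonneg (fun _ _ => zero_le_one) _)
  have h1 := exp_pos (d * m + (b - d) * y)
  have h2 := exp_pos (-(d * M) + (b + d) * y)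
  rw [← Real.exp_add, ← Real.exp_add]
  rcases lt_or_ge y m with hy | hy
  · have : exp (b * y) ≤ exp (d * m + (b - d) * y) := exp_le_exp.2 (by nlinarith)
    linarith
  · rcases lt_or_ge M y with hM | hM
    · have : exp (b * y) ≤ exp (-(d * M) + (b + d) * y) := exp_le_exp.2 (by nlinarith)
      linarith
    · have : exp (b * y) ≤ exp (b * M) * (Ici m).indicator 1 y := by
        rw [indicator_of_mem (mem_Ici.2 hy), Pi.one_apply, mul_one]
        gcongr
      linarith

namespace SolvesMartingaleProblem

variable {Om : Type*} {m0 : MeasurableSpace Om} {μ : Measure Om} [IsProbabilityMeasure μ]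
  {F : Filtration ℝ m0} {f : ℝ → ℝ → ℝ} {g : ℝ → ℝ} {x₀ : ℝ} {X : ℝ → Om → ℝ}

theorem integrable_exp_abs (hX : SolvesMartingaleProblem μ F f g x₀ X) {K θ S : ℝ}
    (hK : 0 < K) (hθ : 0 < θ) (hS : 0 < S)
    (hgen : ∀ x t, 0 ≤ t →
      sdeGenerator f g (expSqrt K θ) x t ≤ 1 / 2 * θ ^ 2 * S * expSqrt K θ x)
    {t : ℝ} (ht : 0 ≤ t) : Integrable (fun ω => exp (θ * |X t ω|)) μ := by
  have hm := hX.measurable t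
  refine (hX.integrable_of_generator_le (contDiff_expSqrt hK) (expSqrt_nonneg K θ)
    (tendsto_expSqrt hθ) (c := 1 / 2 * θ ^ 2 * S) (by positivity) hgen ht).mono'
    (by fun_prop) (ae_of_all _ fun ω => ?_)
  rw [Real.norm_of_nonneg (exp_pos _).le]
  exact exp_abs_le_expSqrt K θ _

theorem setIntegral_exp_abs_le (hX : SolvesMartingaleProblem μ F f g x₀ X) {K θ S : ℝ}
    (hK : 0 < K) (hθ : 0 < θ) (hS : 0 < S)
    (hgen : ∀ x t, 0 ≤ t →
      sdeGenerator f g (expSqrt K θ) x t ≤ 1 / 2 * θ ^ 2 * S * expSqrt K θ x)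
    {s t k : ℝ} (hs : 0 ≤ s) (hst : s ≤ t) {B : Set Om} (hB : MeasurableSet[F s] B)
    (hk : ∀ ω ∈ B, θ * |X s ω| ≤ k) :
    ∫ ω in B, exp (θ * |X t ω|) ∂μ ≤
      exp (1 / 2 * θ ^ 2 * S * (t - s) + (K + k)) * μ.real B := by
  have hi : ∀ u, 0 ≤ u → Integrable (fun ω => expSqrt K θ (X u ω)) μ := fun u hu =>
    hX.integrable_of_generator_le (contDiff_expSqrt hK) (expSqrt_nonneg K θ)
      (tendsto_expSqrt hθ) (c := 1 / 2 * θ ^ 2 * S) (by positivity) hgen hu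
  calc ∫ ω in B, exp (θ * |X t ω|) ∂μ
      ≤ ∫ ω in B, expSqrt K θ (X t ω) ∂μ :=
        integral_mono (hX.integrable_exp_abs hK hθ hS hgen (hs.trans hst)).restrict
          (hi t (hs.trans hst)).restrict fun ω => exp_abs_le_expSqrt K θ _
    _ ≤ exp (1 / 2 * θ ^ 2 * S * (t - s)) * ∫ ω in B, expSqrt K θ (X s ω) ∂μ :=
        hX.setIntegral_le_of_generator_le (contDiff_expSqrt hK) (expSqrt_nonneg K θ)
          (tendsto_expSqrt hθ) (by positivity) hgen hs hst hB
    _ ≤ exp (1 / 2 * θ ^ 2 * S * (t - s)) * ∫ ω in B, exp (K + k) ∂μ := by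
        refine mul_le_mul_of_nonneg_left (setIntegral_mono_on (hi s hs).restrict
          (integrable_const _) (F.le s _ hB) fun ω hω =>
            (expSqrt_le_exp_abs hK hθ _).trans (exp_le_exp.2 ?_)) (exp_pos _).le
        linarith [hk ω hω]
    _ = _ := by
        rw [setIntegral_const, smul_eq_mul, Real.exp_add _ (K + k)]
        ring

theorem exp_mul_measureReal_le_setIntegral (hX : SolvesMartingaleProblem μ F f g x₀ X)
    {K θ₀ θ S S' A κ M : ℝ} (hK : 0 < K) (hS : 0 < S)
    (hgen : ∀ θ, 0 < θ → θ ≤ θ₀ → ∀ x t, 0 ≤ t →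
      sdeGenerator f g (expSqrt K θ) x t ≤ 1 / 2 * θ ^ 2 * S * expSqrt K θ x)
    (hg : ∀ x, g x ^ 2 ≤ M) (hA : 0 < A) (hS' : 0 < S') (hκ : 0 < κ) (hκ1 : κ ≤ 1)
    (hθ : 0 < θ) (hθ' : 4 * θ ≤ θ₀)
    (hgen' : ∀ x t, 0 ≤ t →
      1 / 2 * θ ^ 2 * S' * coshSinh A θ x ≤ sdeGenerator f g (coshSinh A θ) x t)
    {s t : ℝ} (hs : 0 ≤ s) (hst : s ≤ t) {B : Set Om} (hB : MeasurableSet[F s] B) :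
    exp (1 / 2 * θ ^ 2 * S' * (t - s)) * μ.real B ≤
      (1 + A / κ) * ∫ ω in B, exp ((1 + κ) * (θ * |X t ω|)) ∂μ := by
  have h4 : 0 < 4 * θ := by positivity
  have hei : Integrable (fun ω => exp ((1 + κ) * (θ * |X t ω|))) μ := by
    have h1 : 0 < (1 + κ) * θ := by positivity
    simpa only [mul_assoc] using hX.integrable_exp_abs hK h1 hS
      (hgen _ h1 (by nlinarith)) (hs.trans hst)
  have hi : ∀ u, 0 ≤ u → Integrable (fun ω => exp (4 * θ * |X u ω|)) μ := fun u hu =>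
    hX.integrable_exp_abs hK h4 hS (hgen _ h4 hθ') hu
  have hD : ∀ u ∈ Icc s t, ∫ ω, (1 + A) ^ 2 * (1 + θ ^ 2) * exp (4 * θ * |X u ω|) ∂μ ≤
      (1 + A) ^ 2 * (1 + θ ^ 2) * exp (1 / 2 * (4 * θ) ^ 2 * S * t + (K + 4 * θ * |x₀|)) :=
    fun u hu => by
      have h := hX.setIntegral_exp_abs_le hK h4 hS (hgen _ h4 hθ') le_rfl (hs.trans hu.1)
        MeasurableSet.univ (k := 4 * θ * |x₀|) fun ω _ => by rw [hX.initial]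
      rw [setIntegral_univ, probReal_univ, mul_one, sub_zero] at h
      rw [integral_const_mul]
      refine mul_le_mul_of_nonneg_left (h.trans (exp_le_exp.2 ?_)) (by positivity)
      have := hu.2
      gcongr
  have hψi : ∀ u, 0 ≤ u → Integrable (fun ω => coshSinh A θ (X u ω)) μ := fun u hu => by
    refine ((hi u hu).const_mul (1 + A / 3)).mono' ((contDiff_coshSinh A θ).continuous.measurable.comp
      (hX.measurable u)).aestronglyMeasurable (ae_of_all _ fun ω => ?_)
    rw [Real.norm_of_nonneg (zero_le_one.trans (one_le_coshSinh hA.le _ _))]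
    refine (coshSinh_le_exp hA.le three_pos hθ _).trans_eq ?_
    norm_num [mul_assoc]
  calc exp (1 / 2 * θ ^ 2 * S' * (t - s)) * μ.real B
      = exp (1 / 2 * θ ^ 2 * S' * (t - s)) * ∫ ω in B, (1 : ℝ) ∂μ := by simp
    _ ≤ exp (1 / 2 * θ ^ 2 * S' * (t - s)) * ∫ ω in B, coshSinh A θ (X s ω) ∂μ :=
        mul_le_mul_of_nonneg_left (integral_mono (integrable_const _) (hψi s hs).restrict
          fun ω => one_le_coshSinh hA.le _ _) (exp_pos _).le
    _ ≤ ∫ ω in B, coshSinh A θ (X t ω) ∂μ :=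
        hX.le_setIntegral_of_le_generator (contDiff_coshSinh A θ)
          (fun x => zero_le_one.trans (one_le_coshSinh hA.le θ x)) (tendsto_coshSinh hA.le hθ)
          (by positivity) hgen' hg (sq_add_deriv_sq_coshSinh_le hA.le hθ) hs hst
          (fun u hu => (hi u (hs.trans hu.1)).const_mul _) hD hB
    _ ≤ ∫ ω in B, (1 + A / κ) * exp ((1 + κ) * (θ * |X t ω|)) ∂μ :=
        integral_mono (hψi t (hs.trans hst)).restrict (hei.const_mul _).restrict
          fun ω => coshSinh_le_exp hA.le hκ hθ _
    _ = _ := integral_const_mul _ _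

end SolvesMartingaleProblem

namespace SolvesMartingaleProblem

variable {Om : Type*} {m0 : MeasurableSpace Om} {μ : Measure Om} [IsProbabilityMeasure μ]
  {F : Filtration ℝ m0} {f : ℝ → ℝ → ℝ} {g : ℝ → ℝ} {x₀ : ℝ} {X : ℝ → Om → ℝ}

set_option maxHeartbeats 1000000 in
theorem exp_mul_measureReal_le_add (hX : SolvesMartingaleProblem μ F f g x₀ X)
    {K θ₀ A M v z η l L T : ℝ} (hK : 0 < K) (hv : 0 < v) (hz : 0 < z) (hz1 : z < 1)
    (hη : 0 < η) (hη1 : η < 1 / 3) (hL : 0 < L) (hT : 0 < T) (hl : 0 < l) (hlT : l ^ 2 * T = 2 * L)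
    (hgen : ∀ θ, 0 < θ → θ ≤ θ₀ → ∀ x t, 0 ≤ t →
      sdeGenerator f g (expSqrt K θ) x t ≤ 1 / 2 * θ ^ 2 * (v ^ 2 * (1 + z)) * expSqrt K θ x)
    (hg : ∀ x, g x ^ 2 ≤ M) (hA : 0 < A) (hlθ : 4 / v * l ≤ θ₀)
    (hgen' : ∀ θ, 0 < θ → θ ≤ θ₀ → ∀ x t, 0 ≤ t →
      1 / 2 * θ ^ 2 * (v ^ 2 * (1 - z)) * coshSinh A θ x ≤ sdeGenerator f g (coshSinh A θ) x t)
    {B : Set Om} (hB : MeasurableSet[F (z ^ 2 * T)] B)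
    (hk : ∀ ω ∈ B, l * |X (z ^ 2 * T) ω| ≤ 4 * L * v * z) :
    exp (L * ((1 - 2 * η) ^ 2 * (1 - z) * (1 - z ^ 2))) * μ.real B ≤
      (1 + A / z) * ((exp (K + L * (((1 - 2 * η) * (1 + z) - η) ^ 2 * (1 + z) +
          4 * ((1 - 2 * η) * (1 + z) - η) * z + 2 * η * (1 - 3 * η))) +
        exp (K + L * (((1 - 2 * η) * (1 + z) + η) ^ 2 * (1 + z) +
          4 * ((1 - 2 * η) * (1 + z) + η) * z - 2 * η * (1 - η)))) * μ.real B +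
        exp (L * (2 * (1 - 2 * η) * (1 + z) * (1 - η))) *
          μ.real (B ∩ {ω | (1 - 3 * η) * v * (2 * L) ≤ l * |X T ω|})) := by
  set s := z ^ 2 * T with hs
  have hs0 : 0 ≤ s := by positivity
  have hz2 : z ^ 2 ≤ 1 := by nlinarith
  have hsT : s ≤ T := mul_le_of_le_one_left hT.le hz2
  have hlv : 0 < l / v := by positivity
  have hlv4 : 4 * (l / v) ≤ θ₀ := by convert hlθ using 1; ring
  have hupper : ∀ a, 0 < a → a ≤ 4 → Integrable (fun ω => exp (a / v * (l * |X T ω|))) μ ∧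
      ∫ ω in B, exp (a / v * (l * |X T ω|)) ∂μ ≤
        exp (K + L * (a ^ 2 * (1 + z) + 4 * a * z)) * μ.real B := fun a ha ha4 => by
    have hθ : 0 < a * (l / v) := by positivity
    have hθ' : a * (l / v) ≤ θ₀ := le_trans (by gcongr) hlv4
    have hS : 0 < v ^ 2 * (1 + z) := by positivity
    have e : ∀ y, a / v * (l * y) = a * (l / v) * y := fun y => by ring
    simp_rw [e]
    refine ⟨hX.integrable_exp_abs hK hθ hS (hgen _ hθ hθ') hT.le, ?_⟩
    refine (hX.setIntegral_exp_abs_le hK hθ hS (hgen _ hθ hθ') hs0 hsT hB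
      (k := L * (4 * a * z)) fun ω hω => ?_).trans ?_
    · calc a * (l / v) * |X s ω| = a / v * (l * |X s ω|) := by ring
        _ ≤ a / v * (4 * L * v * z) := mul_le_mul_of_nonneg_left (hk ω hω) (by positivity)
        _ = L * (4 * a * z) := by field_simp
    · refine mul_le_mul_of_nonneg_right (exp_le_exp.2 ?_) measureReal_nonneg
      have e1 : 1 / 2 * (a * (l / v)) ^ 2 * (v ^ 2 * (1 + z)) * T = L * (a ^ 2 * (1 + z)) := by
        field_simp
        linear_combination hlT
      have e2 : 0 ≤ 1 / 2 * (a * (l / v)) ^ 2 * (v ^ 2 * (1 + z)) * s := by positivity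
      rw [mul_sub, mul_add L]
      linarith
  have hβ : 0 < 1 - 2 * η := by linarith
  set b := (1 - 2 * η) * (1 + z) / v with hb
  set d := η / v with hd
  have hlow := hX.exp_mul_measureReal_le_setIntegral hK (by positivity) hgen hg hA
    (S' := v ^ 2 * (1 - z)) (mul_pos (by positivity) (by linarith)) hz hz1.le
    (θ := (1 - 2 * η) * (l / v)) (by positivity) (by nlinarith)
    (hgen' _ (by positivity) (by nlinarith)) hs0 hsT hB
  have e0 : 1 / 2 * ((1 - 2 * η) * (l / v)) ^ 2 * (v ^ 2 * (1 - z)) * (T - s) =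
      L * ((1 - 2 * η) ^ 2 * (1 - z) * (1 - z ^ 2)) := by
    rw [hs]
    field_simp
    linear_combination (1 - z ^ 2) * (1 - z) * hlT
  have e1 : ∀ y, (1 + z) * ((1 - 2 * η) * (l / v) * y) = b * (l * y) := fun y => by
    rw [hb]; ring
  rw [e0] at hlow
  simp_rw [e1] at hlow
  refine hlow.trans (mul_le_mul_of_nonneg_left ?_ (by positivity))
  obtain ⟨i1, u1⟩ := hupper ((1 - 2 * η) * (1 + z) - η) (by nlinarith) (by nlinarith)
  obtain ⟨i2, u2⟩ := hupper ((1 - 2 * η) * (1 + z) + η) (by positivity) (by nlinarith)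
  have e2 : ((1 - 2 * η) * (1 + z) - η) / v = b - d := by rw [hb, hd]; ring
  have e3 : ((1 - 2 * η) * (1 + z) + η) / v = b + d := by rw [hb, hd]; ring
  rw [e2] at i1 u1
  rw [e3] at i2 u2
  obtain ⟨i0, -⟩ := hupper ((1 - 2 * η) * (1 + z)) (by positivity) (by nlinarith)
  have hm := hX.measurable T
  set m := (1 - 3 * η) * v * (2 * L) with hmdef
  set M' := (1 - η) * v * (2 * L) with hM'def
  have hAm : MeasurableSet {ω | m ≤ l * |X T ω|} :=
    measurableSet_le measurable_const (hm.abs.const_mul l)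
  have i3 : Integrable (fun ω => exp (b * M') * (Ici m).indicator 1 (l * |X T ω|)) μ :=
    (((integrable_const (1 : ℝ)).indicator hAm).const_mul (exp (b * M')))
  have i12 : Integrable (fun ω => exp (d * m) * exp ((b - d) * (l * |X T ω|)) +
      exp (-(d * M')) * exp ((b + d) * (l * |X T ω|))) μ :=
    (i1.const_mul _).add (i2.const_mul _)
  have e4 : ∀ U, exp (d * m) * exp (K + L * U) = exp (K + L * (U + 2 * η * (1 - 3 * η))) :=
    fun U => by
      rw [← Real.exp_add, hd, hmdef]
      congr 1
      field_simp
      ring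
  have e5 : ∀ U, exp (-(d * M')) * exp (K + L * U) = exp (K + L * (U - 2 * η * (1 - η))) :=
    fun U => by
      rw [← Real.exp_add, hd, hM'def]
      congr 1
      field_simp
      ring
  have e6 : b * M' = L * (2 * (1 - 2 * η) * (1 + z) * (1 - η)) := by
    rw [hb, hM'def]
    field_simp
  calc ∫ ω in B, exp (b * (l * |X T ω|)) ∂μ
      ≤ ∫ ω in B, (exp (d * m) * exp ((b - d) * (l * |X T ω|)) +
          exp (-(d * M')) * exp ((b + d) * (l * |X T ω|)) +
          exp (b * M') * (Ici m).indicator 1 (l * |X T ω|)) ∂μ :=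
        integral_mono i0.restrict
          (i12.add i3).restrict
          fun ω => exp_mul_le_add_indicator (by positivity) (by positivity) m M' _
    _ = exp (d * m) * ∫ ω in B, exp ((b - d) * (l * |X T ω|)) ∂μ +
          exp (-(d * M')) * ∫ ω in B, exp ((b + d) * (l * |X T ω|)) ∂μ +
          exp (b * M') * μ.real (B ∩ {ω | m ≤ l * |X T ω|}) := by
        rw [integral_add i12.restrict i3.restrict,
          integral_add (i1.const_mul _).restrict (i2.const_mul _).restrict,
          integral_const_mul, integral_const_mul, integral_const_mul]
        congr 2
        have : (fun ω => (Ici m).indicator (1 : ℝ → ℝ) (l * |X T ω|)) =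
          {ω | m ≤ l * |X T ω|}.indicator 1 := rfl
        rw [this, integral_indicator_one hAm, measureReal_restrict_apply hAm, inter_comm]
    _ ≤ _ := by
        refine (add_le_add_left (add_le_add (mul_le_mul_of_nonneg_left u1 (exp_pos _).le)
          (mul_le_mul_of_nonneg_left u2 (exp_pos _).le)) _).trans_eq ?_
        rw [← mul_assoc, e4, ← mul_assoc, e5, e6, add_mul]

/-- A uniform conditional lower bound for large values of `X` along a geometric sequence. -/
theorem exists_mul_measureReal_le_measureReal_inter (hX : SolvesMartingaleProblem μ F f g x₀ X)
    {σ ρ mu η : ℝ} (hσ : σ ≠ 0) (hg0 : ∀ x, g x ≠ 0) (hglim : Tendsto g (cocompact ℝ) (nhds σ))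
    (hρ : ∀ y t : ℝ, 0 ≤ t → y * f y t ≤ ρ)
    (hmu : ∀ y t : ℝ, 0 ≤ t → mu * g y ^ 2 ≤ y * f y t) (hmu2 : -1 / 2 < mu)
    (hη : 0 < η) (hη1 : η < 1 / 3) :
    ∃ q > 1, ∃ p < 1, ∃ c > 0, ∀ᶠ n : ℕ in atTop, ∀ B, MeasurableSet[F (q ^ n)] B →
      (∀ ω ∈ B, |X (q ^ n) ω| ≤ 2 * |σ| * √(2 * q ^ n * log (log (q ^ n)))) →
      c * exp (-(p * log (log (q ^ (n + 1))))) * μ.real B ≤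
        μ.real (B ∩ {ω | (1 - 3 * η) * |σ| * √(2 * q ^ (n + 1) * log (log (q ^ (n + 1)))) ≤
          |X (q ^ (n + 1)) ω|}) := by
  obtain ⟨z, hz, hz1, hE1, hE2, hE3⟩ := exists_exponents_lt hη
  set E₀ := (1 - 2 * η) ^ 2 * (1 - z) * (1 - z ^ 2) with hE₀
  have hv : 0 < |σ| := abs_pos.2 hσ
  have hσ2 : 0 < |σ| ^ 2 := by positivity
  obtain ⟨M, -, hM⟩ := exists_forall_sq_le_of_tendsto hX.continuous_diffusion hglim
  obtain ⟨K, hK, θ₀, hθ₀, hgen⟩ := exists_sdeGenerator_expSqrt_le hX.continuous_diffusion hglim hρ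
    (S := |σ| ^ 2 * (1 + z)) (by rw [← sq_abs]; nlinarith)
  obtain ⟨A, hA, θ₁, hθ₁, hgen'⟩ := exists_le_sdeGenerator_coshSinh hX.continuous_diffusion hg0
    hglim hmu hmu2 (S := |σ| ^ 2 * (1 - z)) (mul_pos hσ2 (by linarith))
    (by rw [← sq_abs σ]; nlinarith)
  set q := (z ^ 2)⁻¹ with hq
  have hq1 : 1 < q := (one_lt_inv₀ (by positivity)).2 (by nlinarith)
  have hpow : Tendsto (fun n : ℕ => q ^ (n + 1)) atTop atTop :=
    (tendsto_pow_atTop_atTop_of_one_lt hq1).comp (tendsto_add_atTop_nat 1)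
  refine ⟨q, hq1, 2 * (1 - 2 * η) * (1 + z) * (1 - η) - E₀, hE3,
    1 / (2 * (1 + A / z)), by positivity, ?_⟩
  filter_upwards [((tendsto_sqrt_log_log_div_atTop (4 / |σ|)).comp hpow).eventually_le_const
      (lt_min hθ₀ hθ₁), (tendsto_pow_atTop_atTop_of_one_lt hq1).eventually_ge_atTop (exp 1),
    (tendsto_log_log_atTop.comp hpow).eventually_gt_atTop 0,
    (tendsto_log_log_atTop.comp hpow).eventually (eventually_mul_exp_add_exp_le hE1 hE2
      (1 + A / z) K)] with n h1 h2 h3 h4 B hB hBk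
  simp only [Function.comp_apply] at h1 h3 h4
  set T := q ^ (n + 1) with hT
  set L := log (log T) with hLdef
  have hT0 : 0 < T := by positivity
  have hsT : q ^ n = z ^ 2 * T := by
    have h5 : z ^ 2 * q = 1 := mul_inv_cancel₀ (by positivity)
    rw [hT, pow_succ]
    linear_combination -(q ^ n) * h5
  set l := √(2 * L / T) with hldef
  have hl : 0 < l := by positivity
  have hlT : l ^ 2 * T = 2 * L := by
    rw [hldef, Real.sq_sqrt (by positivity)]
    field_simp
  have hlsq : l * √(2 * T * L) = 2 * L := by
    rw [hldef, ← Real.sqrt_mul (by positivity)]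
    rw [show 2 * L / T * (2 * T * L) = (2 * L) ^ 2 by field_simp]
    exact Real.sqrt_sq (by positivity)
  have hset : {ω | (1 - 3 * η) * |σ| * √(2 * T * L) ≤ |X T ω|} =
      {ω | (1 - 3 * η) * |σ| * (2 * L) ≤ l * |X T ω|} := by
    ext ω
    simp only [mem_ofPred_eq]
    rw [← hlsq, ← mul_le_mul_iff_right₀ hl]
    ring_nf
  rw [hset]
  have hqT : q ^ n ≤ T := pow_le_pow_right₀ hq1.le (Nat.le_succ n)
  have hk : ∀ ω ∈ B, l * |X (z ^ 2 * T) ω| ≤ 4 * L * |σ| * z := fun ω hω => by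
    have hs := hBk ω hω
    have hLs : log (log (q ^ n)) ≤ L := by
      have h5 := (exp_pos 1).trans_le h2
      refine Real.log_le_log ?_ (Real.log_le_log h5 hqT)
      exact one_pos.trans_le ((Real.le_log_iff_exp_le h5).2 h2)
    have h6 : √(2 * q ^ n * log (log (q ^ n))) ≤ z * √(2 * T * L) := by
      rw [← Real.sqrt_sq hz.le, ← Real.sqrt_mul (by positivity)]
      refine Real.sqrt_le_sqrt ?_
      rw [hsT] at hLs ⊢
      have : 0 ≤ 2 * (z ^ 2 * T) := by positivity
      nlinarith [mul_le_mul_of_nonneg_left hLs this]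
    rw [← hsT]
    calc l * |X (q ^ n) ω| ≤ l * (2 * |σ| * (z * √(2 * T * L))) := by
          gcongr; exact hs.trans (by gcongr)
      _ = 4 * L * |σ| * z := by linear_combination 2 * |σ| * z * hlsq
  rw [hsT] at hB
  have key := hX.exp_mul_measureReal_le_add (θ₀ := min θ₀ θ₁) hK hv hz hz1 hη hη1 h3 hT0 hl hlT
    (fun θ h h' => hgen θ h (h'.trans (min_le_left _ _))) hM hA h1
    (fun θ h h' => hgen' θ h (h'.trans (min_le_right _ _))) hB hk
  set P := μ.real (B ∩ {ω | (1 - 3 * η) * |σ| * (2 * L) ≤ l * |X T ω|})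
  have h5 : exp (L * E₀) * μ.real B ≤ 1 / 2 * exp (L * E₀) * μ.real B +
      (1 + A / z) * (exp (L * (2 * (1 - 2 * η) * (1 + z) * (1 - η))) * P) := by
    refine key.trans ?_
    rw [mul_add, ← mul_assoc]
    gcongr
  set D := 1 + A / z with hD
  have hD0 : 0 < D := by positivity
  set E₃ := 2 * (1 - 2 * η) * (1 + z) * (1 - η)
  have h6 : exp (-((E₃ - E₀) * L)) = exp (L * E₀) * (exp (L * E₃))⁻¹ := by
    rw [← Real.exp_neg, ← Real.exp_add]
    congr 1
    ring
  have h7 := exp_pos (L * E₃)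
  calc 1 / (2 * D) * exp (-((E₃ - E₀) * L)) * μ.real B
      = (D * exp (L * E₃))⁻¹ * (exp (L * E₀) * μ.real B - 1 / 2 * exp (L * E₀) * μ.real B) := by
        rw [h6]
        field_simp
        ring
    _ ≤ (D * exp (L * E₃))⁻¹ * (D * (exp (L * E₃) * P)) := by
        gcongr
        linarith
    _ = P := by field_simp

end SolvesMartingaleProblem

/-- A conditional Borel–Cantelli lemma: if, on `G n`, the conditional probability of `A (n + 1)`
given the past is at least `c n` with `∑ c n = ∞`, then `A` occurs infinitely often almost surely
on the event that `G` holds eventually. -/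
theorem ae_frequently_mem_of_mul_measureReal_le {Om : Type*} {m0 : MeasurableSpace Om}
    {μ : Measure Om} [IsProbabilityMeasure μ] {𝒢 : Filtration ℕ m0} {G A : ℕ → Set Om} {c : ℕ → ℝ}
    (hG : ∀ n, MeasurableSet[𝒢 n] (G n)) (hA : ∀ n, MeasurableSet[𝒢 n] (A n))
    (hc0 : ∀ n, 0 ≤ c n) (hc : ¬ Summable c)
    (h : ∀ᶠ n in atTop, ∀ B, MeasurableSet[𝒢 n] B → B ⊆ G n →
      c n * μ.real B ≤ μ.real (B ∩ A (n + 1))) :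
    ∀ᵐ ω ∂μ, (∀ᶠ n in atTop, ω ∈ G n) → ∃ᶠ n in atTop, ω ∈ A n := by
  obtain ⟨n₀, hn₀⟩ := eventually_atTop.1 h
  set D : ℕ → ℕ → Set Om := fun n m => ⋂ j ∈ Iio m, (G (n + j) \ A (n + j + 1)) with hD
  have hDm : ∀ n m, MeasurableSet[𝒢 (n + m)] (D n m) := fun n m =>
    @MeasurableSet.biInter _ _ (𝒢 (n + m)) _ _ (to_countable _) fun j hj => by
      have hj : j < m := hj
      exact MeasurableSet.diff (𝒢.mono (by omega) _ (hG _)) (𝒢.mono (by omega) _ (hA _))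
  have hDs : ∀ n m, D n (m + 1) = (D n m ∩ G (n + m)) \ A (n + m + 1) := fun n m => by
    ext ω
    simp only [hD, mem_iInter, mem_Iio, Set.mem_sdiff, mem_inter_iff, Nat.lt_succ_iff_lt_or_eq]
    constructor
    · intro h
      exact ⟨⟨fun j hj => h j (Or.inl hj), (h m (Or.inr rfl)).1⟩, (h m (Or.inr rfl)).2⟩
    · rintro ⟨⟨h1, h2⟩, h3⟩ j (hj | rfl)
      exacts [h1 j hj, ⟨h2, h3⟩]
  have hDle : ∀ n ≥ n₀, ∀ m, μ.real (D n m) ≤ exp (-∑ j ∈ Finset.range m, c (n + j)) := by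
    intro n hn m
    induction m with
    | zero => simp
    | succ m ih =>
      have h1 := hn₀ (n + m) (by omega) _ (MeasurableSet.inter (hDm n m) (hG (n + m)))
        inter_subset_right
      have h2 := measureReal_inter_add_sdiff (μ := μ) (s := D n m ∩ G (n + m))
        (𝒢.le _ _ (hA (n + m + 1)))
      rw [hDs, Finset.sum_range_succ, neg_add, Real.exp_add]
      calc μ.real ((D n m ∩ G (n + m)) \ A (n + m + 1))
          ≤ (1 - c (n + m)) * μ.real (D n m ∩ G (n + m)) := by linarith
        _ ≤ exp (-c (n + m)) * μ.real (D n m) := by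
            exact mul_le_mul (Real.one_sub_le_exp_neg _) (measureReal_mono inter_subset_left)
              measureReal_nonneg (exp_pos _).le
        _ ≤ exp (-c (n + m)) * exp (-∑ j ∈ Finset.range m, c (n + j)) := by gcongr
        _ = _ := mul_comm _ _
  have hnull : ∀ n ≥ n₀, μ (⋂ m, D n m) = 0 := fun n hn => by
    have hsum : Tendsto (fun m => ∑ j ∈ Finset.range m, c (n + j)) atTop atTop := by
      refine (not_summable_iff_tendsto_nat_atTop_of_nonneg fun j => hc0 _).1 fun hs => hc ?_
      refine (summable_nat_add_iff n).1 (hs.congr fun j => ?_)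
      rw [add_comm]
    have hlim := tendsto_exp_atBot.comp (tendsto_neg_atTop_atBot.comp hsum)
    have : μ.real (⋂ m, D n m) ≤ 0 := ge_of_tendsto' hlim fun m =>
      (measureReal_mono (iInter_subset _ m)).trans (hDle n hn m)
    exact (measureReal_eq_zero_iff).1 (le_antisymm this measureReal_nonneg)
  have hall : ∀ᵐ ω ∂μ, ∀ n : ℕ, n₀ ≤ n → ω ∉ ⋂ m, D n m :=
    ae_all_iff.2 fun n => by
      by_cases hn : n₀ ≤ n
      · filter_upwards [measure_eq_zero_iff_ae_notMem.1 (hnull n hn)] with ω h _ using h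
      · exact ae_of_all _ fun ω h => absurd h hn
  filter_upwards [hall] with ω hω hev
  by_contra hfr
  rw [not_frequently] at hfr
  obtain ⟨n₁, hn₁⟩ := eventually_atTop.1 (hev.and hfr)
  refine hω (max n₀ n₁) (le_max_left _ _) (mem_iInter.2 fun m => mem_iInter₂.2 fun j _ => ⟨?_, ?_⟩)
  · exact (hn₁ _ (by omega)).1
  · exact (hn₁ _ (by omega)).2

namespace SolvesMartingaleProblem

variable {Om : Type*} {m0 : MeasurableSpace Om} {μ : Measure Om} [IsProbabilityMeasure μ]
  {F : Filtration ℝ m0} {f : ℝ → ℝ → ℝ} {g : ℝ → ℝ} {x₀ : ℝ} {X : ℝ → Om → ℝ}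

/-- The lower bound in the law of the iterated logarithm. -/
theorem ae_frequently_le_abs (hX : SolvesMartingaleProblem μ F f g x₀ X)
    {σ ρ mu η : ℝ} (hσ : σ ≠ 0) (hg0 : ∀ x, g x ≠ 0) (hglim : Tendsto g (cocompact ℝ) (nhds σ))
    (hρ : ∀ y t : ℝ, 0 ≤ t → y * f y t ≤ ρ)
    (hmu : ∀ y t : ℝ, 0 ≤ t → mu * g y ^ 2 ≤ y * f y t) (hmu2 : -1 / 2 < mu)
    (hη : 0 < η) (hη1 : η < 1 / 3) :
    ∀ᵐ ω ∂μ, ∃ᶠ t in atTop, (1 - 3 * η) * |σ| * √(2 * t * log (log t)) ≤ |X t ω| := by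
  obtain ⟨q, hq, p, hp, c, hc, h⟩ :=
    hX.exists_mul_measureReal_le_measureReal_inter hσ hg0 hglim hρ hmu hmu2 hη hη1
  let 𝒢 : Filtration ℕ m0 :=
    { seq := fun n => F (q ^ n)
      mono' := fun i j hij => F.mono (pow_le_pow_right₀ hq.le hij)
      le' := fun n => F.le _ }
  have hXm : ∀ n, Measurable[𝒢 n] fun ω => |X (q ^ n) ω| := fun n =>
    measurable_norm.comp (hX.adapted (q ^ n))
  have hpow : Tendsto (fun n : ℕ => q ^ n) atTop atTop := tendsto_pow_atTop_atTop_of_one_lt hq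
  have hbc := ae_frequently_mem_of_mul_measureReal_le (μ := μ) (𝒢 := 𝒢)
    (G := fun n => {ω | |X (q ^ n) ω| ≤ 2 * |σ| * √(2 * q ^ n * log (log (q ^ n)))})
    (A := fun n => {ω | (1 - 3 * η) * |σ| * √(2 * q ^ n * log (log (q ^ n))) ≤ |X (q ^ n) ω|})
    (c := fun n => c * exp (-(p * log (log (q ^ (n + 1))))))
    (fun n => hXm n measurableSet_Iic) (fun n => hXm n measurableSet_Ici)
    (fun n => by positivity) (fun hs => ?_) (h.mono fun n hn B hB hBG => hn B hB hBG)
  · have hσ0 := abs_pos.2 hσ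
    filter_upwards [hbc, hX.ae_eventually_abs_le hglim hρ (r := 2 * |σ|) (by linarith)]
      with ω hω hup
    exact hpow.frequently (hω (hpow.eventually hup))
  · rw [summable_mul_left_iff hc.ne',
      summable_nat_add_iff (f := fun n : ℕ => exp (-(p * log (log (q ^ n))))) 1,
      summable_exp_neg_mul_log_log_pow_iff hq] at hs
    linarith

end SolvesMartingaleProblem

theorem limsup_div_eq_of_forall {u v : ℝ → ℝ} {l : ℝ}
    (hv : ∀ᶠ t in atTop, 0 < v t)
    (hle : ∀ n : ℕ, ∀ᶠ t in atTop, u t ≤ (l + 1 / (n + 1)) * v t)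
    (hge : ∀ n : ℕ, ∃ᶠ t in atTop, (1 - 3 * (1 / ((n : ℝ) + 1 + 3))) * l * v t ≤ u t) :
    limsup (fun t => u t / v t) atTop = l := by
  have hle' : ∀ n : ℕ, ∀ᶠ t in atTop, u t / v t ≤ l + 1 / (n + 1) := fun n => by
    filter_upwards [hv, hle n] with t h1 h2 using (div_le_iff₀ h1).2 h2
  have hge' : ∀ n : ℕ, ∃ᶠ t in atTop, (1 - 3 * (1 / ((n : ℝ) + 1 + 3))) * l ≤ u t / v t :=
    fun n => ((hge n).and_eventually hv).mono fun t ht => (le_div_iff₀ ht.2).2 ht.1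
  have hbdd : IsBoundedUnder (· ≤ ·) atTop fun t => u t / v t := ⟨_, hle' 0⟩
  have hcob : IsCoboundedUnder (· ≤ ·) atTop fun t => u t / v t :=
    IsCoboundedUnder.of_frequently_ge (hge' 0)
  have hlim : Tendsto (fun n : ℕ => 1 / ((n : ℝ) + 1)) atTop (nhds 0) :=
    tendsto_one_div_add_atTop_nhds_zero_nat
  have hlim' : Tendsto (fun n : ℕ => 1 / ((n : ℝ) + 1 + 3)) atTop (nhds 0) := by
    refine (hlim.comp (tendsto_add_atTop_nat 3)).congr fun n => ?_
    simp only [Function.comp_apply]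
    push_cast
    ring
  apply le_antisymm
  · refine ge_of_tendsto' (x := atTop) (f := fun n : ℕ => l + 1 / ((n : ℝ) + 1)) ?_
      fun n => limsup_le_of_le hcob (hle' n)
    simpa using hlim.const_add l
  · refine le_of_tendsto' (x := atTop) (f := fun n : ℕ => (1 - 3 * (1 / ((n : ℝ) + 1 + 3))) * l) ?_
      fun n => le_limsup_of_frequently_le (hge' n) hbdd
    simpa using ((hlim'.const_mul 3).const_sub 1).mul_const l

/-- Main theorem: if `f, g` are locally Lipschitz, `g` is even, nowhere zero, with
`g(x) → σ ≠ 0` as `|x| → ∞`, `sup_{x,t} x f(x,t) ≤ ρ` and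
`inf_{x,t} x f(x,t)/g(x)² = μ > −1/2`, then the solution `X` of
`dX = f(X,t) dt + g(X) dB` (formulated via the martingale problem) obeys the Law of
the Iterated Logarithm `limsup |X(t)|/√(2 t log log t) = |σ|` a.s. -/
theorem lil_for_recurrent_sde
    {Om : Type*} {m0 : MeasurableSpace Om} (μ : Measure Om) [IsProbabilityMeasure μ]
    (F : Filtration ℝ m0) (f : ℝ → ℝ → ℝ) (g : ℝ → ℝ) (σ ρ mu x₀ : ℝ)
    (hf : LocallyLipschitz fun p : ℝ × ℝ => f p.1 p.2)
    (hg : LocallyLipschitz g) (hgeven : ∀ y, g (-y) = g y)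
    (hg0 : ∀ y, g y ≠ 0) (hσ : σ ≠ 0)
    (hglim : Tendsto g (Filter.cocompact ℝ) (nhds σ))
    (hρ : ∀ y t : ℝ, 0 ≤ t → y * f y t ≤ ρ)
    (hmu : IsGLB {r : ℝ | ∃ y t : ℝ, 0 ≤ t ∧ r = y * f y t / (g y) ^ 2} mu)
    (hmu2 : -1/2 < mu)
    (X : ℝ → Om → ℝ)
    (hadapt : Adapted F X)
    (hcont : ∀ ω, ContinuousOn (fun t => X t ω) (Ici 0))
    (hinit : ∀ ω, X 0 ω = x₀)
    (hmartprob : ∀ φ : ℝ → ℝ, ContDiff ℝ 2 φ → HasCompactSupport φ →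
      Martingale (fun t ω => φ (X t ω) -
        ∫ s in Ioc (0:ℝ) t,
          (f (X s ω) s * deriv φ (X s ω) +
            (1 / 2) * (g (X s ω)) ^ 2 * deriv (deriv φ) (X s ω))) F μ) :
    ∀ᵐ ω ∂μ, Filter.limsup (fun t : ℝ =>
        |X t ω| / Real.sqrt (2 * t * Real.log (Real.log t))) atTop = |σ| := by
  have hX : SolvesMartingaleProblem μ F f g x₀ X :=
    ⟨hf.continuous, hg.continuous, hadapt, hcont, hinit, hmartprob⟩
  have hmu' : ∀ y t : ℝ, 0 ≤ t → mu * g y ^ 2 ≤ y * f y t := fun y t ht =>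
    (le_div_iff₀ (sq_pos_of_ne_zero (hg0 y))).1 (hmu.1 ⟨y, t, ht, rfl⟩)
  have hup : ∀ᵐ ω ∂μ, ∀ n : ℕ, ∀ᶠ t in atTop,
      |X t ω| ≤ (|σ| + 1 / (n + 1)) * √(2 * t * log (log t)) :=
    ae_all_iff.2 fun n => hX.ae_eventually_abs_le hglim hρ
      (lt_add_of_pos_right _ Nat.one_div_pos_of_nat)
  have hlow : ∀ᵐ ω ∂μ, ∀ n : ℕ, ∃ᶠ t in atTop,
      (1 - 3 * (1 / ((n : ℝ) + 1 + 3))) * |σ| * √(2 * t * log (log t)) ≤ |X t ω| :=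
    ae_all_iff.2 fun n => hX.ae_frequently_le_abs hσ hg0 hglim hρ hmu' hmu2 (by positivity)
      (one_div_lt_one_div_of_lt (by norm_num) (by linarith [n.cast_nonneg (α := ℝ)]))
  filter_upwards [hup, hlow] with ω h1 h2
  refine limsup_div_eq_of_forall ?_ h1 h2
  filter_upwards [tendsto_log_log_atTop.eventually_gt_atTop 0, eventually_gt_atTop 0] with t h3 h4
  positivity
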